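/- For every integer k ≥ 2 and every μ > 2k(k+1), there exist at least 2(k−2)+2 pairwise distinct functions f ∈ C²([0,∞)) with f'(0)=0 satisfying f''(r) + f'(r)/r + μ (1+r²)^{−2} ( e^{2f(r)} − 1 ) = 0 on (0,∞) and ∫₀^∞ e^{2f(r)} (1+r²)^{−2} r dr = 1/2, one of which is the zero function f ≡ 0. -/

import Mathlib

open Real Set MeasureTheory Filter

noncomputable section

/-- `f` is a radial solution of the normalized equation
`f'' + f'/r + μ(1+r²)^{-2}(e^{2f}−1) = 0` on `(0,∞)`, of class `C²` on `[0,∞)`,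
with `f'(0) = 0` and `∫₀^∞ e^{2f}(1+r²)^{-2} r dr = 1/2`. -/
def IsNormalizedSol (μ : ℝ) (f : ℝ → ℝ) : Prop :=
  ContDiffOn ℝ 2 f (Ici 0) ∧ derivWithin f (Ici 0) 0 = 0 ∧
  (∀ r : ℝ, 0 < r →
    deriv (deriv f) r + deriv f r / r
      + μ / (1 + r ^ 2) ^ 2 * (Real.exp (2 * f r) - 1) = 0) ∧
  IntegrableOn (fun r => Real.exp (2 * f r) / (1 + r ^ 2) ^ 2 * r) (Ioi 0) ∧
  (∫ r in Ioi (0:ℝ), Real.exp (2 * f r) / (1 + r ^ 2) ^ 2 * r) = 1 / 2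

open scoped Topology NNReal

/-! ### Monotonicity helpers -/

lemma le_of_hasDerivAt_nonneg {u u' : ℝ → ℝ} {a b : ℝ} (hab : a ≤ b)
    (h : ∀ t ∈ Icc a b, HasDerivAt u (u' t) t) (h0 : ∀ t ∈ Icc a b, 0 ≤ u' t) : u a ≤ u b := by
  have : MonotoneOn u (Icc a b) := by
    refine monotoneOn_of_deriv_nonneg (convex_Icc a b)
      (fun t ht => (h t ht).continuousAt.continuousWithinAt)
      (fun t ht => (h t (interior_subset ht)).differentiableAt.differentiableWithinAt)
      (fun t ht => ?_)
    rw [(h t (interior_subset ht)).deriv]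
    exact h0 t (interior_subset ht)
  exact this (left_mem_Icc.2 hab) (right_mem_Icc.2 hab) hab

lemma lt_of_hasDerivAt_pos {u u' : ℝ → ℝ} {a b : ℝ} (hab : a < b)
    (h : ∀ t ∈ Icc a b, HasDerivAt u (u' t) t) (h0 : ∀ t ∈ Ioo a b, 0 < u' t) : u a < u b := by
  have : StrictMonoOn u (Icc a b) := by
    refine strictMonoOn_of_deriv_pos (convex_Icc a b)
      (fun t ht => (h t ht).continuousAt.continuousWithinAt) (fun t ht => ?_)
    rw [(h t (interior_subset ht)).deriv]
    exact h0 t (by simpa using ht)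
  exact this (left_mem_Icc.2 hab.le) (right_mem_Icc.2 hab.le) hab

lemma le_of_tendsto_atBot_of_hasDerivAt_nonneg {u u' : ℝ → ℝ} {l b : ℝ}
    (hl : Tendsto u atBot (𝓝 l)) (h : ∀ t ≤ b, HasDerivAt u (u' t) t)
    (h0 : ∀ t ≤ b, 0 ≤ u' t) : l ≤ u b := by
  refine le_of_tendsto hl ?_
  filter_upwards [eventually_le_atBot b] with t ht
  exact le_of_hasDerivAt_nonneg ht (fun s hs => h s hs.2) (fun s hs => h0 s hs.2)

lemma exists_first_zero {u : ℝ → ℝ} (hu : Continuous u) {a b : ℝ} (hab : a ≤ b)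
    (ha : 0 < u a) (hb : u b ≤ 0) : ∃ c ∈ Ioc a b, u c = 0 ∧ ∀ t ∈ Ico a c, 0 < u t := by
  have hK : IsCompact (Icc a b ∩ u ⁻¹' Iic 0) :=
    isCompact_Icc.inter_right (isClosed_Iic.preimage hu)
  obtain ⟨c, ⟨hc, hc0⟩, hmin⟩ := hK.exists_isLeast ⟨b, right_mem_Icc.2 hab, hb⟩
  have hpos : ∀ t ∈ Ico a c, 0 < u t := by
    intro t ht
    by_contra hn
    exact absurd (hmin ⟨⟨ht.1, ht.2.le.trans hc.2⟩, not_lt.1 hn⟩) (not_le.2 ht.2)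
  have hac : a < c := lt_of_le_of_ne hc.1 (by rintro rfl; exact absurd hc0 (not_le.2 ha))
  refine ⟨c, ⟨hac, hc.2⟩, le_antisymm hc0 ?_, hpos⟩
  have h1 : Tendsto u (𝓝[<] c) (𝓝 (u c)) := hu.continuousAt.continuousWithinAt
  refine ge_of_tendsto h1 ?_
  filter_upwards [Ico_mem_nhdsLT hac] with t ht using (hpos t ht).le

/-! ### The weight -/

/-- The squared hyperbolic secant, `1 / cosh² t`. -/
def sechSq (t : ℝ) : ℝ := 4 * exp (2 * t) / (1 + exp (2 * t)) ^ 2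

/-- The hyperbolic tangent in exponential form. -/
def expTanh (t : ℝ) : ℝ := 1 - 2 / (1 + exp (2 * t))

lemma sechSq_pos (t : ℝ) : 0 < sechSq t := by unfold sechSq; positivity

lemma hasDerivAt_exp_two_mul (t : ℝ) : HasDerivAt (fun t => exp (2 * t)) (2 * exp (2 * t)) t := by
  have := ((hasDerivAt_id t).const_mul 2).exp
  simpa [mul_comm] using this

lemma hasDerivAt_expTanh (t : ℝ) : HasDerivAt expTanh (sechSq t) t := by
  have h := ((hasDerivAt_exp_two_mul t).const_add 1)
  have h2 := ((hasDerivAt_const t (2:ℝ)).div h (by positivity)).const_sub 1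
  exact h2.congr_deriv (by unfold sechSq; ring)

lemma expTanh_sq (t : ℝ) : expTanh t ^ 2 = 1 - sechSq t := by
  unfold expTanh sechSq
  have : (1 + exp (2 * t)) ≠ 0 := by positivity
  field_simp; ring

lemma abs_expTanh_le (t : ℝ) : |expTanh t| ≤ 1 := by
  rw [← sq_le_one_iff_abs_le_one, expTanh_sq]; linarith [sechSq_pos t]

lemma hasDerivAt_sechSq (t : ℝ) : HasDerivAt sechSq (-(2 * expTanh t * sechSq t)) t := by
  have h : sechSq = fun t => 1 - expTanh t ^ 2 := by
    funext t; rw [expTanh_sq]; ring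
  have h2 : HasDerivAt (fun t => 1 - expTanh t ^ 2) (-(2 * expTanh t * sechSq t)) t :=
    (((hasDerivAt_expTanh t).pow 2).const_sub 1).congr_deriv (by push_cast; ring)
  rwa [← h] at h2

lemma continuous_sechSq : Continuous sechSq :=
  continuous_iff_continuousAt.2 fun t => (hasDerivAt_sechSq t).continuousAt

lemma tendsto_exp_two_mul_atBot : Tendsto (fun t : ℝ => exp (2 * t)) atBot (𝓝 0) :=
  tendsto_exp_atBot.comp (tendsto_id.const_mul_atBot (by norm_num : (0:ℝ) < 2))

lemma tendsto_exp_two_mul_atTop : Tendsto (fun t : ℝ => exp (2 * t)) atTop atTop :=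
  tendsto_exp_atTop.comp (tendsto_id.const_mul_atTop (by norm_num : (0:ℝ) < 2))

lemma tendsto_expTanh_atBot : Tendsto expTanh atBot (𝓝 (-1)) := by
  have h := (tendsto_const_nhds (x := (2:ℝ))).div
    (tendsto_exp_two_mul_atBot.const_add 1) (by norm_num)
  have := h.const_sub 1
  norm_num at this
  exact this

lemma tendsto_expTanh_atTop : Tendsto expTanh atTop (𝓝 1) := by
  have h := (tendsto_const_nhds (x := (2:ℝ))).div_atTop
    (tendsto_atTop_add_const_left _ 1 tendsto_exp_two_mul_atTop)
  have := h.const_sub 1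
  rw [sub_zero] at this
  exact this

lemma sechSq_le_exp (t : ℝ) : sechSq t ≤ 4 * exp (2 * t) := by
  unfold sechSq
  apply div_le_self (by positivity)
  nlinarith [exp_pos (2 * t)]

lemma exp_le_sechSq {t : ℝ} (ht : t ≤ 0) : exp (2 * t) ≤ sechSq t := by
  unfold sechSq
  have h1 : exp (2 * t) ≤ 1 := exp_le_one_iff.2 (by linarith)
  have h0 := exp_pos (2 * t)
  rw [le_div_iff₀ (by positivity)]
  have : (1 + exp (2 * t)) ^ 2 ≤ 4 := by nlinarith
  nlinarith

lemma exp_neg_le_sechSq {t : ℝ} (ht : 0 ≤ t) : exp (-(2 * t)) ≤ sechSq t := by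
  unfold sechSq
  have h1 : 1 ≤ exp (2 * t) := one_le_exp (by linarith)
  rw [exp_neg, le_div_iff₀ (by positivity), inv_mul_le_iff₀ (by positivity)]
  nlinarith

lemma sechSq_le_exp_neg (t : ℝ) : sechSq t ≤ 4 * exp (-(2 * t)) := by
  unfold sechSq
  have h0 := exp_pos (2 * t)
  rw [exp_neg, div_le_iff₀ (by positivity)]
  have : 4 * (exp (2 * t))⁻¹ * (1 + exp (2 * t)) ^ 2
      = 4 * (exp (2 * t))⁻¹ + 8 + 4 * exp (2 * t) := by field_simp; ring
  rw [this]
  have : 0 < (exp (2 * t))⁻¹ := by positivity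
  linarith

lemma sechSq_eq (t : ℝ) : sechSq t = 1 / cosh t ^ 2 := by
  unfold sechSq
  rw [cosh_eq, two_mul, exp_add, exp_neg]
  have := exp_pos t
  field_simp
  ring

lemma one_add_sq_div_two_le_cosh (t : ℝ) : 1 + t ^ 2 / 2 ≤ cosh t := by
  have h1 : cosh t = 1 + 2 * sinh (t / 2) ^ 2 := by
    have := cosh_two_mul (t / 2)
    rw [show 2 * (t / 2) = t by ring, cosh_sq] at this
    linarith
  have h2 : (t / 2) ^ 2 ≤ sinh (t / 2) ^ 2 := by
    rw [sq_le_sq]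
    rcases le_total 0 (t / 2) with h | h
    · rw [abs_of_nonneg h]; exact (self_le_sinh_iff.2 h).trans (le_abs_self _)
    · rw [abs_of_nonpos h, ← abs_neg, ← sinh_neg]
      exact (self_le_sinh_iff.2 (by linarith)).trans (le_abs_self _)
  rw [h1]; linarith

lemma sechSq_mul_le (t : ℝ) : sechSq t * (1 + t ^ 2) ≤ 4 / (1 + t ^ 2) := by
  have h := one_add_sq_div_two_le_cosh t
  have h1 : (0:ℝ) < 1 + t ^ 2 := by positivity
  rw [sechSq_eq, le_div_iff₀ h1, one_div_mul_eq_div, div_mul_eq_mul_div,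
    div_le_iff₀ (by positivity)]
  nlinarith [sq_nonneg t]

lemma tendsto_mul_exp_atBot : Tendsto (fun t : ℝ => t * exp t) atBot (𝓝 0) := by
  have h := (tendsto_pow_mul_exp_neg_atTop_nhds_zero 1).comp tendsto_neg_atBot_atTop
  have h2 := h.neg
  simpa [Function.comp_def] using h2

/-! ### The angle of a solution of a linear equation

For `y'' + Q y = 0` the vector `(y - t y', y')` has limits at both ends when `Q` decays fast;
its polar angle is monotone. -/

/-- The squared length of `(y - t y', y')`. -/
def phaseNormSq (y G : ℝ → ℝ) (t : ℝ) : ℝ := (y t - t * G t) ^ 2 + G t ^ 2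

/-- The angular speed of `(y - t y', y')`. -/
def phaseSpeed (Q y G : ℝ → ℝ) (t : ℝ) : ℝ := Q t * y t ^ 2 / phaseNormSq y G t

/-- The angle swept by `(y - t y', y')` on `(-∞, t]`. -/
def phase (Q y G : ℝ → ℝ) (t : ℝ) : ℝ := ∫ s in Iic t, phaseSpeed Q y G s

/-- The angle swept by `(y - t y', y')` on the whole line. -/
def totalPhase (Q y G : ℝ → ℝ) : ℝ := ∫ s, phaseSpeed Q y G s

/-- `y' = G`, `G' = -Q y`, with `y → a ≠ 0` at `-∞` and `Q` decaying like `t⁻⁴`. -/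
structure IsLinSol (Q y G : ℝ → ℝ) (a C : ℝ) : Prop where
  deriv_fst : ∀ t, HasDerivAt y (G t) t
  deriv_snd : ∀ t, HasDerivAt G (-(Q t * y t)) t
  cont : Continuous Q
  nonneg : ∀ t, 0 ≤ Q t
  bound : ∀ t, Q t * (1 + t ^ 2) ≤ C / (1 + t ^ 2)
  lim_fst : Tendsto (fun t => y t - t * G t) atBot (𝓝 a)
  lim_snd : Tendsto G atBot (𝓝 0)
  ne_zero : a ≠ 0

/-- A primitive of `C / (1 + t²)` vanishing at `-∞`. -/
def arctanPrim (C t : ℝ) : ℝ := C * (arctan t + π / 2)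

lemma hasDerivAt_arctanPrim (C t : ℝ) : HasDerivAt (arctanPrim C) (C / (1 + t ^ 2)) t :=
  (((hasDerivAt_arctan t).add_const (π / 2)).const_mul C).congr_deriv (by ring)

lemma tendsto_arctanPrim (C : ℝ) : Tendsto (arctanPrim C) atBot (𝓝 0) := by
  have h : Tendsto arctan atBot (𝓝 (-(π / 2))) :=
    tendsto_nhds_of_tendsto_nhdsWithin tendsto_arctan_atBot
  have := (h.add_const (π / 2)).const_mul C
  rw [neg_add_cancel, mul_zero] at this
  exact this

lemma arctanPrim_nonneg {C : ℝ} (hC : 0 ≤ C) (t : ℝ) : 0 ≤ arctanPrim C t :=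
  mul_nonneg hC (by linarith [neg_pi_div_two_lt_arctan t])

lemma arctanPrim_le {C : ℝ} (hC : 0 ≤ C) (t : ℝ) : arctanPrim C t ≤ C * π :=
  mul_le_mul_of_nonneg_left (by linarith [arctan_lt_pi_div_two t]) hC

namespace IsLinSol

variable {Q y G : ℝ → ℝ} {a C : ℝ}

lemma const_nonneg (h : IsLinSol Q y G a C) : 0 ≤ C := by
  have h1 := h.bound 0
  have h2 := h.nonneg 0
  norm_num at h1
  linarith

lemma cont_fst (h : IsLinSol Q y G a C) : Continuous y :=
  continuous_iff_continuousAt.2 fun t => (h.deriv_fst t).continuousAt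

lemma cont_snd (h : IsLinSol Q y G a C) : Continuous G :=
  continuous_iff_continuousAt.2 fun t => (h.deriv_snd t).continuousAt

lemma hasDerivAt_intercept (h : IsLinSol Q y G a C) (t : ℝ) :
    HasDerivAt (fun t => y t - t * G t) (t * (Q t * y t)) t :=
  ((h.deriv_fst t).sub ((hasDerivAt_id t).mul (h.deriv_snd t))).congr_deriv (by simp)

lemma hasDerivAt_phaseNormSq (h : IsLinSol Q y G a C) (t : ℝ) :
    HasDerivAt (phaseNormSq y G)
      (2 * (Q t * y t) * (t * (y t - t * G t) - G t)) t :=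
  (((h.hasDerivAt_intercept t).pow 2).add ((h.deriv_snd t).pow 2)).congr_deriv
    (by push_cast; ring)

lemma sq_le (y G : ℝ → ℝ) (t : ℝ) : y t ^ 2 ≤ (1 + t ^ 2) * phaseNormSq y G t := by
  unfold phaseNormSq
  nlinarith [sq_nonneg (G t - t * (y t - t * G t))]

lemma phaseNormSq_ge (h : IsLinSol Q y G a C) (t : ℝ) :
    a ^ 2 * exp (-(2 * (C * π))) ≤ phaseNormSq y G t := by
  have hd : ∀ s ≤ t, HasDerivAt (fun s => phaseNormSq y G s * exp (2 * arctanPrim C s))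
      (2 * (Q s * y s) * (s * (y s - s * G s) - G s) * exp (2 * arctanPrim C s)
        + phaseNormSq y G s * (exp (2 * arctanPrim C s) * (2 * (C / (1 + s ^ 2))))) s :=
    fun s _ => (h.hasDerivAt_phaseNormSq s).mul (((hasDerivAt_arctanPrim C s).const_mul 2).exp)
  have hlim : Tendsto (fun s => phaseNormSq y G s * exp (2 * arctanPrim C s)) atBot
      (𝓝 (a ^ 2)) := by
    have h1 := ((h.lim_fst.pow 2).add (h.lim_snd.pow 2)).mul
      ((continuous_exp.tendsto _).comp ((tendsto_arctanPrim C).const_mul 2))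
    simpa [phaseNormSq, Function.comp_def] using h1
  have key := le_of_tendsto_atBot_of_hasDerivAt_nonneg hlim hd (fun s _ => by
    have h1 : |2 * (y s * (s * (y s - s * G s) - G s))|
        ≤ (1 + s ^ 2) * phaseNormSq y G s * 2 := by
      unfold phaseNormSq
      rw [abs_le]
      constructor <;>
      nlinarith [sq_nonneg (y s + (s * (y s - s * G s) - G s)),
        sq_nonneg (y s - (s * (y s - s * G s) - G s)), sq_nonneg (y s - s * G s), sq_nonneg (G s),
        mul_nonneg (sq_nonneg s) (sq_nonneg (y s - s * G s)),
        mul_nonneg (sq_nonneg s) (sq_nonneg (G s))]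
    have h2 := (abs_le.1 h1).1
    have h3 : 0 ≤ phaseNormSq y G s := by unfold phaseNormSq; positivity
    have h4 := mul_le_mul_of_nonneg_right (h.bound s) h3
    have h5 := mul_le_mul_of_nonneg_left h2 (h.nonneg s)
    have h6 : 0 ≤ 2 * (Q s * y s) * (s * (y s - s * G s) - G s)
        + phaseNormSq y G s * (2 * (C / (1 + s ^ 2))) := by nlinarith
    have := mul_nonneg h6 (exp_pos (2 * arctanPrim C s)).le
    linarith)
  have h3 : 0 ≤ phaseNormSq y G t := by unfold phaseNormSq; positivity
  have h4 : exp (2 * arctanPrim C t) ≤ exp (2 * (C * π)) :=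
    exp_le_exp.2 (by linarith [arctanPrim_le h.const_nonneg t])
  rw [exp_neg, ← div_eq_mul_inv, div_le_iff₀ (exp_pos _)]
  exact key.trans (mul_le_mul_of_nonneg_left h4 h3)

lemma phaseNormSq_pos (h : IsLinSol Q y G a C) (t : ℝ) : 0 < phaseNormSq y G t :=
  lt_of_lt_of_le (mul_pos (pow_two_pos_of_ne_zero h.ne_zero) (exp_pos _)) (h.phaseNormSq_ge t)

lemma phaseSpeed_nonneg (h : IsLinSol Q y G a C) (t : ℝ) : 0 ≤ phaseSpeed Q y G t :=
  div_nonneg (mul_nonneg (h.nonneg t) (sq_nonneg _)) (h.phaseNormSq_pos t).le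

lemma phaseSpeed_le (h : IsLinSol Q y G a C) (t : ℝ) :
    phaseSpeed Q y G t ≤ C / (1 + t ^ 2) := by
  refine le_trans ?_ (h.bound t)
  unfold phaseSpeed
  rw [div_le_iff₀ (h.phaseNormSq_pos t), mul_assoc]
  exact mul_le_mul_of_nonneg_left (sq_le y G t) (h.nonneg t)

lemma continuous_phaseSpeed (h : IsLinSol Q y G a C) : Continuous (phaseSpeed Q y G) := by
  unfold phaseSpeed
  refine (h.cont.mul (h.cont_fst.pow 2)).div ?_ (fun t => (h.phaseNormSq_pos t).ne')
  have h1 := h.cont_fst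
  have h2 := h.cont_snd
  unfold phaseNormSq
  fun_prop

lemma integrable_bound (C : ℝ) : Integrable (fun t : ℝ => C / (1 + t ^ 2)) :=
  integrable_inv_one_add_sq.const_mul C

lemma integrable_phaseSpeed (h : IsLinSol Q y G a C) : Integrable (phaseSpeed Q y G) := by
  refine (integrable_bound C).mono' h.continuous_phaseSpeed.aestronglyMeasurable
    (Eventually.of_forall fun t => ?_)
  rw [norm_of_nonneg (h.phaseSpeed_nonneg t)]
  exact h.phaseSpeed_le t

lemma phase_eq (h : IsLinSol Q y G a C) (t : ℝ) :
    phase Q y G t = phase Q y G 0 + ∫ s in (0:ℝ)..t, phaseSpeed Q y G s := by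
  have := intervalIntegral.integral_Iic_sub_Iic (a := 0) (b := t)
    h.integrable_phaseSpeed.integrableOn h.integrable_phaseSpeed.integrableOn
  unfold phase
  linarith

lemma hasDerivAt_phase (h : IsLinSol Q y G a C) (t : ℝ) :
    HasDerivAt (phase Q y G) (phaseSpeed Q y G t) t := by
  have h1 := (intervalIntegral.integral_hasDerivAt_right
    (h.continuous_phaseSpeed.intervalIntegrable 0 t)
    (h.continuous_phaseSpeed.stronglyMeasurableAtFilter _ _)
    h.continuous_phaseSpeed.continuousAt).const_add (phase Q y G 0)
  rwa [← (funext h.phase_eq : phase Q y G = _)] at h1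

lemma tendsto_phase_atTop (h : IsLinSol Q y G a C) :
    Tendsto (phase Q y G) atTop (𝓝 (totalPhase Q y G)) := by
  have h1 := intervalIntegral_tendsto_integral_Ioi (0:ℝ)
    h.integrable_phaseSpeed.integrableOn tendsto_id
  have h2 := h1.const_add (phase Q y G 0)
  have h3 : phase Q y G 0 + ∫ s in Ioi (0:ℝ), phaseSpeed Q y G s = totalPhase Q y G :=
    intervalIntegral.integral_Iic_add_Ioi h.integrable_phaseSpeed.integrableOn
      h.integrable_phaseSpeed.integrableOn
  rw [h3] at h2
  exact h2.congr fun t => (h.phase_eq t).symm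

lemma tendsto_phase_atBot (h : IsLinSol Q y G a C) :
    Tendsto (phase Q y G) atBot (𝓝 0) := by
  have h1 := intervalIntegral_tendsto_integral_Iic (0:ℝ)
    h.integrable_phaseSpeed.integrableOn tendsto_id
  have h2 := h1.const_sub (phase Q y G 0)
  rw [show phase Q y G 0 - ∫ s in Iic (0:ℝ), phaseSpeed Q y G s = 0 from sub_self _] at h2
  refine h2.congr fun t => ?_
  rw [h.phase_eq t, intervalIntegral.integral_symm]
  simp

lemma monotone_phase (h : IsLinSol Q y G a C) : Monotone (phase Q y G) :=
  monotone_of_hasDerivAt_nonneg h.hasDerivAt_phase h.phaseSpeed_nonneg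

lemma phase_le_total (h : IsLinSol Q y G a C) (t : ℝ) : phase Q y G t ≤ totalPhase Q y G :=
  h.monotone_phase.ge_of_tendsto h.tendsto_phase_atTop t

lemma continuous_phase (h : IsLinSol Q y G a C) : Continuous (phase Q y G) :=
  continuous_iff_continuousAt.2 fun t => (h.hasDerivAt_phase t).continuousAt

lemma phase_nonneg (h : IsLinSol Q y G a C) (t : ℝ) : 0 ≤ phase Q y G t :=
  h.monotone_phase.le_of_tendsto h.tendsto_phase_atBot t

/-- The vector `(y - t y', y')` is parallel to `(cos φ, -sin φ)`. -/
lemma parallel (h : IsLinSol Q y G a C) (t : ℝ) :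
    (y t - t * G t) * sin (phase Q y G t) + G t * cos (phase Q y G t) = 0 := by
  set φ := phase Q y G with hφ
  set S : ℝ → ℝ := fun t => (y t - t * G t) * sin (φ t) + G t * cos (φ t) with hS
  have hSd : ∀ s, HasDerivAt S (s * (Q s * y s) * sin (φ s)
      + (y s - s * G s) * (cos (φ s) * phaseSpeed Q y G s)
      + (-(Q s * y s) * cos (φ s) + G s * (-sin (φ s) * phaseSpeed Q y G s))) s := fun s =>
    ((h.hasDerivAt_intercept s).mul (h.hasDerivAt_phase s).sin).add
      ((h.deriv_snd s).mul (h.hasDerivAt_phase s).cos)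
  have hd : ∀ s ≤ t, HasDerivAt (fun s => -(S s ^ 2 * exp (-(2 * arctanPrim C s))))
      (-((2 * S s * (s * (Q s * y s) * sin (φ s)
      + (y s - s * G s) * (cos (φ s) * phaseSpeed Q y G s)
      + (-(Q s * y s) * cos (φ s) + G s * (-sin (φ s) * phaseSpeed Q y G s))))
        * exp (-(2 * arctanPrim C s))
        + S s ^ 2 * (exp (-(2 * arctanPrim C s)) * (-(2 * (C / (1 + s ^ 2))))))) s :=
    fun s _ => ((((hSd s).pow 2).congr_deriv (by push_cast; ring)).mul
      ((((hasDerivAt_arctanPrim C s).const_mul 2).neg).exp)).neg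
  have hlim : Tendsto (fun s => -(S s ^ 2 * exp (-(2 * arctanPrim C s)))) atBot (𝓝 0) := by
    have h1 := ((((h.lim_fst.mul ((continuous_sin.tendsto _).comp h.tendsto_phase_atBot)).add
      (h.lim_snd.mul ((continuous_cos.tendsto _).comp h.tendsto_phase_atBot))).pow 2).mul
      ((continuous_exp.tendsto _).comp ((tendsto_arctanPrim C).const_mul 2).neg)).neg
    simpa [Function.comp_def] using h1
  have key := le_of_tendsto_atBot_of_hasDerivAt_nonneg hlim hd (fun s _ => by
    have hN := h.phaseNormSq_pos s
    have htrig := sin_sq_add_cos_sq (φ s)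
    set c := cos (φ s)
    set d := sin (φ s)
    set V := y s - s * G s with hV
    set R := V * c - G s * d with hR
    have hSs : S s = V * d + G s * c := rfl
    have hy : y s = R * (c - s * d) + S s * (d + s * c) := by
      rw [hSs, hR]
      linear_combination (-(V + s * G s)) * htrig + hV
    have hNR : phaseNormSq y G s = R ^ 2 + S s ^ 2 := by
      rw [hSs, hR]; unfold phaseNormSq; rw [← hV]
      linear_combination (-(V ^ 2 + G s ^ 2)) * htrig
    set z := (d + s * c) * R - (c - s * d) * S s with hz
    have hS' : (s * (Q s * y s) * d + V * (c * phaseSpeed Q y G s)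
        + (-(Q s * y s) * c + G s * (-d * phaseSpeed Q y G s))) * phaseNormSq y G s
        = Q s * y s * z * S s := by
      have h1 : phaseSpeed Q y G s * phaseNormSq y G s = Q s * y s ^ 2 := by
        unfold phaseSpeed; field_simp
      have h2 : (s * (Q s * y s) * d + V * (c * phaseSpeed Q y G s)
        + (-(Q s * y s) * c + G s * (-d * phaseSpeed Q y G s))) * phaseNormSq y G s
        = Q s * y s * (s * d - c) * phaseNormSq y G s
          + R * (phaseSpeed Q y G s * phaseNormSq y G s) := by rw [hR]; ring
      rw [h2, h1, hNR, hz]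
      have h3 : Q s * y s ^ 2 = Q s * y s * (R * (c - s * d) + S s * (d + s * c)) := by
        rw [← hy]; ring
      rw [h3]; ring
    have hyz : y s ^ 2 + z ^ 2 = (1 + s ^ 2) * phaseNormSq y G s := by
      rw [hNR, hy, hz]
      linear_combination (1 + s ^ 2) * (R ^ 2 + S s ^ 2) * htrig
    have hyz2 : y s * z ≤ (1 + s ^ 2) * phaseNormSq y G s := by
      nlinarith [sq_nonneg (y s - z), sq_nonneg (y s), sq_nonneg z]
    have h5 : S s * (s * (Q s * y s) * d + V * (c * phaseSpeed Q y G s)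
        + (-(Q s * y s) * c + G s * (-d * phaseSpeed Q y G s)))
        ≤ C / (1 + s ^ 2) * S s ^ 2 := by
      have h6 : S s * (s * (Q s * y s) * d + V * (c * phaseSpeed Q y G s)
        + (-(Q s * y s) * c + G s * (-d * phaseSpeed Q y G s)))
        = Q s * (y s * z) * S s ^ 2 / phaseNormSq y G s := by
        rw [eq_div_iff hN.ne', mul_assoc, hS']; ring
      rw [h6, div_le_iff₀ hN]
      have h7 := mul_le_mul_of_nonneg_left hyz2 (h.nonneg s)
      have h8 := mul_le_mul_of_nonneg_right (h.bound s) hN.le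
      have h9 : Q s * (y s * z) ≤ C / (1 + s ^ 2) * phaseNormSq y G s := by linarith
      have := mul_le_mul_of_nonneg_right h9 (sq_nonneg (S s))
      linarith
    have := mul_le_mul_of_nonneg_right h5 (exp_pos (-(2 * arctanPrim C s))).le
    linarith)
  have h1 : S t ^ 2 * exp (-(2 * arctanPrim C t)) ≤ 0 := by linarith
  have h2 : S t ^ 2 ≤ 0 := by
    by_contra hn
    exact absurd h1 (not_le.2 (mul_pos (not_le.1 hn) (exp_pos _)))
  exact pow_eq_zero_iff (two_ne_zero) |>.1 (le_antisymm h2 (sq_nonneg _))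

/-- The angular speed in terms of the angle itself. -/
lemma phaseSpeed_eq (h : IsLinSol Q y G a C) (t : ℝ) :
    phaseSpeed Q y G t = Q t * (cos (phase Q y G t) - t * sin (phase Q y G t)) ^ 2 := by
  have hp := h.parallel t
  have htrig := sin_sq_add_cos_sq (phase Q y G t)
  have hN := h.phaseNormSq_pos t
  unfold phaseSpeed
  rw [div_eq_iff hN.ne']
  set c := cos (phase Q y G t)
  set d := sin (phase Q y G t)
  set V := y t - t * G t with hV
  have hy : y t = (V * c - G t * d) * (c - t * d) := by
    linear_combination (-(V + t * G t)) * htrig + hV + (d + t * c) * hp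
  have hNR : phaseNormSq y G t = (V * c - G t * d) ^ 2 := by
    unfold phaseNormSq; rw [← hV]
    linear_combination (-(V ^ 2 + G t ^ 2)) * htrig + (V * d + G t * c) * hp
  rw [hNR, hy]; ring

lemma sin_phase_eq_zero_iff (h : IsLinSol Q y G a C) (t : ℝ) :
    sin (phase Q y G t) = 0 ↔ G t = 0 := by
  have hp := h.parallel t
  have htrig := sin_sq_add_cos_sq (phase Q y G t)
  constructor
  · intro hs
    rw [hs] at hp htrig
    have : cos (phase Q y G t) ≠ 0 := by
      intro hc; rw [hc] at htrig; norm_num at htrig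
    simpa [this] using hp
  · intro hG
    have hN := h.phaseNormSq_pos t
    unfold phaseNormSq at hN
    rw [hG] at hp hN
    rcases mul_eq_zero.1 (by simpa using hp : y t * sin (phase Q y G t) = 0) with h1 | h1
    · simp [h1] at hN
    · exact h1

end IsLinSol

/-! ### Comparison of angles -/

lemma hasDerivAt_max_zero_sq (x : ℝ) :
    HasDerivAt (fun x : ℝ => max x 0 ^ 2) (2 * max x 0) x := by
  rcases lt_trichotomy x 0 with hx | rfl | hx
  · rw [max_eq_right hx.le, mul_zero]
    refine (hasDerivAt_const x (0:ℝ)).congr_of_eventuallyEq ?_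
    filter_upwards [Iio_mem_nhds hx] with z hz
    simp [max_eq_right (mem_Iio.1 hz).le]
  · rw [max_self, mul_zero, hasDerivAt_iff_isLittleO]
    have h1 : (fun z : ℝ => z * z) =o[𝓝 0] fun z : ℝ => z * 1 :=
      (Asymptotics.isBigO_refl _ _).mul_isLittleO
        ((Asymptotics.isLittleO_one_iff ℝ).2 tendsto_id)
    refine (Asymptotics.IsBigO.of_bound 1 (Eventually.of_forall fun z => ?_)).trans_isLittleO
      (h1.congr_right (g₂ := fun z => z - 0) (by simp))
    simp only [max_self, smul_zero, sub_zero, norm_mul, norm_eq_abs, one_mul]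
    have : |max z 0| ≤ |z| := by
      rcases le_total z 0 with h | h <;> simp [h]
    have h0 : max z 0 ^ 2 - 0 ^ 2 = max z 0 * max z 0 := by ring
    rw [h0, abs_mul]
    exact mul_self_le_mul_self (abs_nonneg _) this
  · rw [max_eq_left hx.le]
    refine ((hasDerivAt_pow 2 x).congr_deriv (by simp)).congr_of_eventuallyEq ?_
    filter_upwards [Ioi_mem_nhds hx] with z hz
    simp [max_eq_left (mem_Ioi.1 hz).le]

/-- The quadratic form giving the angular speed per unit of potential. -/
def angleForm (t φ : ℝ) : ℝ := (cos φ - t * sin φ) ^ 2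

lemma abs_cos_sub_mul_sin_le (t φ : ℝ) : |cos φ - t * sin φ| ≤ 1 + |t| := by
  refine (abs_sub _ _).trans (add_le_add (abs_cos_le_one φ) ?_)
  rw [abs_mul]
  exact mul_le_of_le_one_right (abs_nonneg t) (abs_sin_le_one φ)

lemma one_add_abs_sq_le (t : ℝ) : (1 + |t|) ^ 2 ≤ 2 * (1 + t ^ 2) := by
  nlinarith [sq_nonneg (1 - |t|), sq_abs t]

lemma angleForm_le (t φ : ℝ) : angleForm t φ ≤ 2 * (1 + t ^ 2) := by
  refine le_trans ?_ (one_add_abs_sq_le t)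
  rw [angleForm, ← sq_abs]
  exact pow_le_pow_left₀ (abs_nonneg _) (abs_cos_sub_mul_sin_le t φ) 2

lemma abs_angleForm_sub_le (t φ ψ : ℝ) :
    |angleForm t φ - angleForm t ψ| ≤ 4 * (1 + t ^ 2) * |φ - ψ| := by
  have h1 : angleForm t φ - angleForm t ψ = ((cos φ - cos ψ) - t * (sin φ - sin ψ))
      * ((cos φ - t * sin φ) + (cos ψ - t * sin ψ)) := by unfold angleForm; ring
  have h2 : |(cos φ - cos ψ) - t * (sin φ - sin ψ)| ≤ (1 + |t|) * |φ - ψ| := by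
    refine (abs_sub _ _).trans ?_
    rw [abs_mul, add_mul, one_mul]
    exact add_le_add (abs_cos_sub_cos_le φ ψ)
      (mul_le_mul_of_nonneg_left (abs_sin_sub_sin_le φ ψ) (abs_nonneg t))
  have h3 : |(cos φ - t * sin φ) + (cos ψ - t * sin ψ)| ≤ 2 * (1 + |t|) := by
    refine (abs_add_le _ _).trans ?_
    linarith [abs_cos_sub_mul_sin_le t φ, abs_cos_sub_mul_sin_le t ψ]
  rw [h1, abs_mul]
  refine (mul_le_mul h2 h3 (abs_nonneg _) (by positivity)).trans ?_
  have := mul_le_mul_of_nonneg_right (one_add_abs_sq_le t) (abs_nonneg (φ - ψ))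
  linarith

lemma angleForm_nonneg (t φ : ℝ) : 0 ≤ angleForm t φ := sq_nonneg _

/-- If `φ` and `ψ` start together at `-∞` and the potential driving `ψ` is the larger one, then
`ψ` stays ahead. -/
lemma phase_le_of_le {κ T : ℝ} (hκ : 0 ≤ κ) {φ ψ Q : ℝ → ℝ}
    (hφ : ∀ t ≤ T, HasDerivAt φ (κ * sechSq t * angleForm t (φ t)) t)
    (hψ : ∀ t ≤ T, HasDerivAt ψ (Q t * angleForm t (ψ t)) t)
    (hQ : ∀ t ≤ T, κ * sechSq t ≤ Q t)
    (hφ0 : Tendsto φ atBot (𝓝 0)) (hψ0 : Tendsto ψ atBot (𝓝 0)) : φ T ≤ ψ T := by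
  set K := arctanPrim (16 * κ) with hK
  have hd : ∀ t ≤ T, HasDerivAt (fun t => -(max (φ t - ψ t) 0 ^ 2 * exp (-(2 * K t))))
      (-((2 * max (φ t - ψ t) 0 * (κ * sechSq t * angleForm t (φ t) - Q t * angleForm t (ψ t)))
        * exp (-(2 * K t)) + max (φ t - ψ t) 0 ^ 2 *
          (exp (-(2 * K t)) * (-(2 * (16 * κ / (1 + t ^ 2))))))) t := fun t ht =>
    (((hasDerivAt_max_zero_sq _).comp t ((hφ t ht).sub (hψ t ht))).mul
      ((((hasDerivAt_arctanPrim (16 * κ) t).const_mul 2).neg).exp)).neg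
  have hlim : Tendsto (fun t => -(max (φ t - ψ t) 0 ^ 2 * exp (-(2 * K t)))) atBot (𝓝 0) := by
    have h1 := ((((hφ0.sub hψ0).max (tendsto_const_nhds (x := (0:ℝ)))).pow 2).mul
      ((continuous_exp.tendsto _).comp
        ((tendsto_arctanPrim (16 * κ)).const_mul 2).neg)).neg
    simpa [Function.comp_def] using h1
  have key := le_of_tendsto_atBot_of_hasDerivAt_nonneg hlim hd (fun t ht => by
    rcases le_total (φ t - ψ t) 0 with h | h
    · simp [max_eq_right h]
    · rw [max_eq_left h]
      have h1 := abs_angleForm_sub_le t (φ t) (ψ t)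
      rw [abs_of_nonneg h] at h1
      have h2 := (le_abs_self _).trans h1
      have h3 := mul_le_mul_of_nonneg_right (hQ t ht) (angleForm_nonneg t (ψ t))
      have hs := mul_nonneg hκ (sechSq_pos t).le
      have h4 := mul_le_mul_of_nonneg_left h2 hs
      have h5 := mul_le_mul_of_nonneg_left (sechSq_mul_le t) (mul_nonneg hκ h)
      have h6 : κ * sechSq t * angleForm t (φ t) - Q t * angleForm t (ψ t)
          ≤ 16 * κ / (1 + t ^ 2) * (φ t - ψ t) := by
        have : 16 * κ / (1 + t ^ 2) * (φ t - ψ t)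
          = 4 * (κ * (φ t - ψ t) * (4 / (1 + t ^ 2))) := by ring
        rw [this]; nlinarith
      have h7 := mul_le_mul_of_nonneg_right (mul_le_mul_of_nonneg_left h6 h)
        (exp_pos (-(2 * K t))).le
      linarith)
  have h1 : max (φ T - ψ T) 0 ^ 2 ≤ 0 := by
    by_contra hn
    have := mul_pos (not_le.1 hn) (exp_pos (-(2 * K T)))
    linarith
  have h2 : max (φ T - ψ T) 0 = 0 := by
    exact pow_eq_zero_iff (two_ne_zero) |>.1 (le_antisymm h1 (sq_nonneg _))
  linarith [le_max_left (φ T - ψ T) 0]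

/-- Quantitative strict comparison of angles. -/
lemma exists_phase_gap {κ κ' κ'' : ℝ} (hκ : 0 ≤ κ) (hκ' : κ < κ') :
    ∃ t₀, ∃ d > 0, ∀ T ≥ t₀, ∀ φ ψ Q : ℝ → ℝ,
      (∀ t ≤ T, HasDerivAt φ (κ * sechSq t * angleForm t (φ t)) t) →
      (∀ t ≤ T, HasDerivAt ψ (Q t * angleForm t (ψ t)) t) →
      (∀ t ≤ T, κ' * sechSq t ≤ Q t) → (∀ t ≤ T, Q t ≤ κ'' * sechSq t) →
      Tendsto φ atBot (𝓝 0) → Tendsto ψ atBot (𝓝 0) → φ T + d ≤ ψ T := by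
  obtain ⟨t₀, ht₀1, ht₀⟩ : ∃ t₀ ≤ (0:ℝ), arctanPrim (8 * κ'') t₀ ≤ 1 :=
    (((eventually_le_atBot 0)).and
      ((tendsto_arctanPrim (8 * κ'')).eventually_le_const (by norm_num : (0:ℝ) < 1))).exists
  have hth : 0 < 1 + expTanh t₀ := by
    unfold expTanh
    have := exp_pos (2 * t₀)
    have : 2 / (1 + exp (2 * t₀)) < 2 := by
      rw [div_lt_iff₀ (by positivity)]; linarith
    linarith
  set e₀ := (κ' - κ) / 4 * (1 + expTanh t₀) with he₀
  have he₀pos : 0 < e₀ := mul_pos (by linarith) hth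
  refine ⟨t₀, e₀ * exp (-(16 * κ * π)), by positivity, ?_⟩
  intro T hT φ ψ Q hφ hψ hQ1 hQ2 hφ0 hψ0
  have hs0 := fun t => (sechSq_pos t)
  have hQκ : ∀ t ≤ T, κ * sechSq t ≤ Q t := fun t ht =>
    (mul_le_mul_of_nonneg_right hκ'.le (hs0 t).le).trans (hQ1 t ht)
  have hQ0 : ∀ t ≤ T, 0 ≤ Q t := fun t ht =>
    (mul_nonneg hκ (hs0 t).le).trans (hQκ t ht)
  have hD : ∀ t ≤ T, 0 ≤ ψ t - φ t := fun t ht => sub_nonneg.2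
    (phase_le_of_le hκ (fun s hs => hφ s (hs.trans ht)) (fun s hs => hψ s (hs.trans ht))
      (fun s hs => hQκ s (hs.trans ht)) hφ0 hψ0)
  have hψnn : ∀ t ≤ T, 0 ≤ ψ t := fun t ht =>
    le_of_tendsto_atBot_of_hasDerivAt_nonneg hψ0 (fun s hs => hψ s (hs.trans ht))
      (fun s hs => mul_nonneg (hQ0 s (hs.trans ht)) (angleForm_nonneg _ _))
  have hκ''0 : 0 ≤ κ'' := by
    have := (hQ0 T le_rfl).trans (hQ2 T le_rfl)
    exact nonneg_of_mul_nonneg_left this (hs0 T)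
  have hψle : ∀ t ≤ t₀, ψ t ≤ 1 := by
    intro t ht
    have hlim : Tendsto (fun t => arctanPrim (8 * κ'') t - ψ t) atBot (𝓝 0) := by
      simpa using (tendsto_arctanPrim (8 * κ'')).sub hψ0
    have h1 := le_of_tendsto_atBot_of_hasDerivAt_nonneg (b := t) hlim
      (fun s hs => (hasDerivAt_arctanPrim _ s).sub (hψ s (hs.trans (ht.trans hT))))
      (fun s hs => by
        have h2 := hQ2 s (hs.trans (ht.trans hT))
        have h3 := mul_le_mul h2 (angleForm_le s (ψ s)) (angleForm_nonneg _ _)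
          (mul_nonneg hκ''0 (hs0 s).le)
        have h4 := mul_le_mul_of_nonneg_left (sechSq_mul_le s) hκ''0
        have h5 : 8 * κ'' / (1 + s ^ 2) = 2 * (κ'' * (4 / (1 + s ^ 2))) := by ring
        rw [h5]; nlinarith)
    have h2 : arctanPrim (8 * κ'') t ≤ arctanPrim (8 * κ'') t₀ :=
      mul_le_mul_of_nonneg_left (by linarith [arctan_mono ht]) (by linarith)
    linarith
  set K := arctanPrim (16 * κ) with hK
  have hEd : ∀ t ≤ T, HasDerivAt (fun t => (ψ t - φ t) * exp (K t))
      ((Q t * angleForm t (ψ t) - κ * sechSq t * angleForm t (φ t)) * exp (K t)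
        + (ψ t - φ t) * (exp (K t) * (16 * κ / (1 + t ^ 2)))) t := fun t ht =>
    ((hψ t ht).sub (hφ t ht)).mul (hasDerivAt_arctanPrim (16 * κ) t).exp
  have hEpos : ∀ t ≤ T, (κ' - κ) * sechSq t * angleForm t (ψ t) ≤
      (Q t * angleForm t (ψ t) - κ * sechSq t * angleForm t (φ t)) * exp (K t)
        + (ψ t - φ t) * (exp (K t) * (16 * κ / (1 + t ^ 2))) := by
    intro t ht
    have h1 := abs_angleForm_sub_le t (φ t) (ψ t)
    rw [abs_sub_comm (φ t), abs_of_nonneg (hD t ht)] at h1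
    have h2 := (le_abs_self _).trans h1
    have h3 := mul_le_mul_of_nonneg_right (hQ1 t ht) (angleForm_nonneg t (ψ t))
    have h4 := mul_le_mul_of_nonneg_left h2 (mul_nonneg hκ (hs0 t).le)
    have h5 := mul_le_mul_of_nonneg_left (sechSq_mul_le t) (mul_nonneg hκ (hD t ht))
    have h6 : (κ' - κ) * sechSq t * angleForm t (ψ t) ≤
        Q t * angleForm t (ψ t) - κ * sechSq t * angleForm t (φ t)
          + (ψ t - φ t) * (16 * κ / (1 + t ^ 2)) := by
      have : (ψ t - φ t) * (16 * κ / (1 + t ^ 2))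
        = 4 * (κ * (ψ t - φ t) * (4 / (1 + t ^ 2))) := by ring
      rw [this]; nlinarith
    have h7 : 1 ≤ exp (K t) := one_le_exp (arctanPrim_nonneg (by linarith) t)
    have h8 : 0 ≤ (κ' - κ) * sechSq t * angleForm t (ψ t) :=
      mul_nonneg (mul_nonneg (by linarith) (hs0 t).le) (angleForm_nonneg _ _)
    have h9 := mul_le_mul_of_nonneg_right h6 (exp_pos (K t)).le
    nlinarith
  have hE1 : e₀ ≤ (ψ t₀ - φ t₀) * exp (K t₀) := by
    have hlim : Tendsto (fun t => (ψ t - φ t) * exp (K t)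
        - (κ' - κ) / 4 * (1 + expTanh t)) atBot (𝓝 0) := by
      have h1 := ((hψ0.sub hφ0).mul ((continuous_exp.tendsto _).comp
        (tendsto_arctanPrim (16 * κ)))).sub
        ((tendsto_expTanh_atBot.const_add 1).const_mul ((κ' - κ) / 4))
      simpa [Function.comp_def] using h1
    have h1 := le_of_tendsto_atBot_of_hasDerivAt_nonneg (b := t₀) hlim
      (fun s hs => (hEd s (hs.trans hT)).sub
        (((hasDerivAt_expTanh s).const_add 1).const_mul ((κ' - κ) / 4)))
      (fun s hs => by
        have h2 := hEpos s (hs.trans hT)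
        have h3 : 1 / 4 ≤ angleForm s (ψ s) := by
          have h4 := hψnn s (hs.trans hT)
          have h5 := hψle s hs
          have h6 : 1 / 2 ≤ cos (ψ s) := by
            have := one_sub_sq_div_two_le_cos (x := ψ s)
            nlinarith
          have h7 : 0 ≤ sin (ψ s) :=
            sin_nonneg_of_nonneg_of_le_pi h4 (by linarith [pi_gt_three])
          have h8 : 1 / 2 ≤ cos (ψ s) - s * sin (ψ s) := by nlinarith
          unfold angleForm; nlinarith
        have h4 : 0 ≤ (κ' - κ) * sechSq s := mul_nonneg (by linarith) (hs0 s).le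
        nlinarith)
    linarith
  have hE2 : (ψ t₀ - φ t₀) * exp (K t₀) ≤ (ψ T - φ T) * exp (K T) :=
    le_of_hasDerivAt_nonneg hT (fun t ht => hEd t ht.2) (fun t ht =>
      le_trans (mul_nonneg (mul_nonneg (by linarith) (hs0 t).le) (angleForm_nonneg _ _))
        (hEpos t ht.2))
  have h1 : exp (K T) ≤ exp (16 * κ * π) := exp_le_exp.2 (arctanPrim_le (by linarith) T)
  have h2 := mul_le_mul_of_nonneg_left h1 (hD T le_rfl)
  have h3 : e₀ * exp (-(16 * κ * π)) ≤ ψ T - φ T := by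
    rw [exp_neg, ← div_eq_mul_inv, div_le_iff₀ (exp_pos _)]
    linarith
  linarith

/-! ### The Legendre comparison solutions -/

/-- The pair `(Pₖ(tanh t), d/dt Pₖ(tanh t))`, with `Pₖ` the Legendre polynomials. -/
def legendrePair : ℕ → ℝ → ℝ × ℝ
  | 0, _ => (1, 0)
  | k + 1, t =>
    (expTanh t * (legendrePair k t).1 - (legendrePair k t).2 / (k + 1),
      (k + 1) * sechSq t * (legendrePair k t).1 + expTanh t * (legendrePair k t).2)

lemma hasDerivAt_legendrePair (k : ℕ) : ∀ t,
    HasDerivAt (fun t => (legendrePair k t).1) (legendrePair k t).2 t ∧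
    HasDerivAt (fun t => (legendrePair k t).2)
      (-((k : ℝ) * (k + 1) * sechSq t * (legendrePair k t).1)) t := by
  induction k with
  | zero =>
    intro t
    refine ⟨hasDerivAt_const t _, (hasDerivAt_const t _).congr_deriv (by simp)⟩
  | succ k ih =>
    intro t
    obtain ⟨h1, h2⟩ := ih t
    have hk : (k : ℝ) + 1 ≠ 0 := by positivity
    refine ⟨(((hasDerivAt_expTanh t).mul h1).sub (h2.div_const _)).congr_deriv ?_,
      ((((hasDerivAt_sechSq t).const_mul ((k : ℝ) + 1)).mul h1).add
        ((hasDerivAt_expTanh t).mul h2)).congr_deriv ?_⟩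
    · simp only [legendrePair]; field_simp; ring
    · simp only [legendrePair]; push_cast; field_simp; ring

lemma exists_legendrePair_bound (k : ℕ) : ∃ C, ∀ t,
    |(legendrePair k t).1| ≤ C ∧ |(legendrePair k t).2| ≤ C * sechSq t := by
  induction k with
  | zero => exact ⟨1, fun t => ⟨by simp [legendrePair], by
      simpa [legendrePair] using (sechSq_pos t).le⟩⟩
  | succ k ih =>
    obtain ⟨C, hC⟩ := ih
    refine ⟨(k + 2) * C, fun t => ?_⟩
    obtain ⟨h1, h2⟩ := hC t
    have h3 := abs_expTanh_le t
    have hs := sechSq_pos t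
    have hs1 : sechSq t ≤ 1 := by nlinarith [expTanh_sq t, sq_nonneg (expTanh t)]
    have hC0 : 0 ≤ C := (abs_nonneg _).trans h1
    have hk : (0 : ℝ) ≤ k := Nat.cast_nonneg k
    simp only [legendrePair]
    constructor
    · refine (abs_sub _ _).trans ?_
      rw [abs_mul, abs_div, abs_of_nonneg (by positivity : (0 : ℝ) ≤ k + 1)]
      have h4 := mul_le_mul h3 h1 (abs_nonneg _) zero_le_one
      have h5 : |(legendrePair k t).2| / (k + 1) ≤ C := by
        rw [div_le_iff₀ (by positivity)]; nlinarith
      nlinarith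
    · refine (abs_add_le _ _).trans ?_
      rw [abs_mul, abs_mul, abs_mul, abs_of_pos hs,
        abs_of_nonneg (by positivity : (0 : ℝ) ≤ k + 1)]
      have h4 := mul_le_mul h3 h2 (abs_nonneg _) zero_le_one
      have h5 := mul_le_mul_of_nonneg_left h1 (by positivity : 0 ≤ ((k : ℝ) + 1) * sechSq t)
      nlinarith

lemma tendsto_inv_one_add_sq (l : Filter ℝ) (hl : Tendsto (fun t : ℝ => t ^ 2) l atTop) (C : ℝ) :
    Tendsto (fun t : ℝ => C / (1 + t ^ 2)) l (𝓝 0) :=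
  tendsto_const_nhds.div_atTop (tendsto_atTop_add_const_left _ _ hl)

lemma tendsto_legendrePair_snd (k : ℕ) (l : Filter ℝ)
    (hl : Tendsto (fun t : ℝ => t ^ 2) l atTop) :
    Tendsto (fun t => (legendrePair k t).2) l (𝓝 0) ∧
    Tendsto (fun t => t * (legendrePair k t).2) l (𝓝 0) := by
  obtain ⟨C, hC⟩ := exists_legendrePair_bound k
  have hC0 : 0 ≤ C := (abs_nonneg _).trans (hC 0).1
  have key : ∀ t, C * sechSq t * (1 + t ^ 2) ≤ 4 * C / (1 + t ^ 2) := fun t => by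
    have := mul_le_mul_of_nonneg_left (sechSq_mul_le t) hC0
    calc _ = C * (sechSq t * (1 + t ^ 2)) := by ring
      _ ≤ _ := this
      _ = _ := by ring
  refine ⟨squeeze_zero_norm (fun t => ?_) (tendsto_inv_one_add_sq l hl (4 * C)),
    squeeze_zero_norm (fun t => ?_) (tendsto_inv_one_add_sq l hl (4 * C))⟩
  · rw [norm_eq_abs]
    refine ((hC t).2.trans ?_).trans (key t)
    exact le_mul_of_one_le_right (mul_nonneg hC0 (sechSq_pos t).le) (by nlinarith [sq_nonneg t])
  · rw [norm_eq_abs, abs_mul]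
    refine (mul_le_mul_of_nonneg_left (hC t).2 (abs_nonneg t)).trans (le_trans ?_ (key t))
    rw [mul_comm]
    refine mul_le_mul_of_nonneg_left ?_ (mul_nonneg hC0 (sechSq_pos t).le)
    nlinarith [sq_nonneg (1 - |t|), sq_abs t]

lemma tendsto_sq_atBot : Tendsto (fun t : ℝ => t ^ 2) atBot atTop :=
  ((tendsto_pow_atTop two_ne_zero).comp tendsto_neg_atBot_atTop).congr fun t => by simp

lemma tendsto_legendrePair_fst_atBot (k : ℕ) :
    Tendsto (fun t => (legendrePair k t).1) atBot (𝓝 ((-1) ^ k)) := by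
  induction k with
  | zero => simp [legendrePair]
  | succ k ih =>
    have := (tendsto_expTanh_atBot.mul ih).sub
      ((tendsto_legendrePair_snd k atBot tendsto_sq_atBot).1.div_const ((k : ℝ) + 1))
    simp only [legendrePair]
    convert this using 2
    rw [pow_succ]; ring

lemma tendsto_legendrePair_fst_atTop (k : ℕ) :
    Tendsto (fun t => (legendrePair k t).1) atTop (𝓝 1) := by
  induction k with
  | zero => simp [legendrePair]
  | succ k ih =>
    have := (tendsto_expTanh_atTop.mul ih).sub
      ((tendsto_legendrePair_snd k atTop (tendsto_pow_atTop two_ne_zero)).1.div_const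
        ((k : ℝ) + 1))
    simp only [legendrePair]
    convert this using 2
    ring

lemma isLinSol_legendrePair (k : ℕ) :
    IsLinSol (fun t => (k : ℝ) * (k + 1) * sechSq t) (fun t => (legendrePair k t).1)
      (fun t => (legendrePair k t).2) ((-1) ^ k) (4 * (k * (k + 1))) where
  deriv_fst t := (hasDerivAt_legendrePair k t).1
  deriv_snd t := (hasDerivAt_legendrePair k t).2
  cont := continuous_const.mul continuous_sechSq
  nonneg t := mul_nonneg (by positivity) (sechSq_pos t).le
  bound t := by
    have := mul_le_mul_of_nonneg_left (sechSq_mul_le t) (by positivity : (0 : ℝ) ≤ k * (k + 1))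
    calc _ = (k : ℝ) * (k + 1) * (sechSq t * (1 + t ^ 2)) := by ring
      _ ≤ _ := this
      _ = _ := by ring
  lim_fst := by
    simpa using (tendsto_legendrePair_fst_atBot k).sub
      (tendsto_legendrePair_snd k atBot tendsto_sq_atBot).2
  lim_snd := (tendsto_legendrePair_snd k atBot tendsto_sq_atBot).1
  ne_zero := pow_ne_zero _ (by norm_num)

lemma exists_totalPhase_legendrePair_eq (k : ℕ) : ∃ n : ℤ, (n : ℝ) * π =
    totalPhase (fun t => (k : ℝ) * (k + 1) * sechSq t) (fun t => (legendrePair k t).1)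
      (fun t => (legendrePair k t).2) := by
  have h := isLinSol_legendrePair k
  have h1 := tendsto_legendrePair_snd k atTop (tendsto_pow_atTop two_ne_zero)
  have h2 := (((tendsto_legendrePair_fst_atTop k).sub h1.2).mul
    ((continuous_sin.tendsto _).comp h.tendsto_phase_atTop)).add
    (h1.1.mul ((continuous_cos.tendsto _).comp h.tendsto_phase_atTop))
  have h3 := tendsto_nhds_unique h2
    ((tendsto_const_nhds (x := (0 : ℝ))).congr fun t => (h.parallel t).symm)
  simp only [sub_zero, one_mul, zero_mul, add_zero] at h3
  exact sin_eq_zero_iff.1 h3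

lemma IsLinSol.hasDerivAt_phase' {Q y G : ℝ → ℝ} {a C : ℝ} (h : IsLinSol Q y G a C) (t : ℝ) :
    HasDerivAt (phase Q y G) (Q t * angleForm t (phase Q y G t)) t :=
  (h.hasDerivAt_phase t).congr_deriv (h.phaseSpeed_eq t)

lemma le_totalPhase_legendrePair (k : ℕ) : (k : ℝ) * π ≤
    totalPhase (fun t => (k : ℝ) * (k + 1) * sechSq t) (fun t => (legendrePair k t).1)
      (fun t => (legendrePair k t).2) := by
  induction k with
  | zero =>
    have h := isLinSol_legendrePair 0
    simpa using (h.phase_nonneg 0).trans (h.phase_le_total 0)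
  | succ k ih =>
    have h := isLinSol_legendrePair k
    have h' := isLinSol_legendrePair (k + 1)
    have hk : (0 : ℝ) ≤ k := Nat.cast_nonneg k
    obtain ⟨t₀, d, hd, H⟩ := exists_phase_gap (κ := (k : ℝ) * (k + 1))
      (κ' := ((k + 1 : ℕ) : ℝ) * ((k + 1 : ℕ) + 1))
      (κ'' := ((k + 1 : ℕ) : ℝ) * ((k + 1 : ℕ) + 1)) (by positivity) (by push_cast; nlinarith)
    have h1 := le_of_tendsto_of_tendsto (h.tendsto_phase_atTop.add_const d) h'.tendsto_phase_atTop
      ((eventually_ge_atTop t₀).mono fun T hT => H T hT _ _ _ (fun t _ => h.hasDerivAt_phase' t)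
        (fun t _ => h'.hasDerivAt_phase' t) (fun t _ => le_rfl) (fun t _ => le_rfl)
        h.tendsto_phase_atBot h'.tendsto_phase_atBot)
    obtain ⟨n, hn⟩ := exists_totalPhase_legendrePair_eq (k + 1)
    rw [← hn] at h1 ⊢
    have h2 : (k : ℝ) * π < n * π := by linarith
    have h3 : (k : ℝ) < n := lt_of_mul_lt_mul_right h2 pi_pos.le
    have h4 : (k : ℤ) + 1 ≤ n := by exact_mod_cast h3
    have h5 : ((k + 1 : ℕ) : ℝ) ≤ n := by exact_mod_cast h4
    exact mul_le_mul_of_nonneg_right h5 pi_pos.le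

/-- A potential exceeding that of the `k`-th Legendre function makes at least `k` half-turns
before a time depending only on the bounds on the potential. -/
lemma exists_mul_pi_le_phase (k : ℕ) {κ' : ℝ} (κ'' : ℝ) (hκ' : (k : ℝ) * (k + 1) < κ') :
    ∃ T, ∀ ψ Q : ℝ → ℝ, (∀ t ≤ T, HasDerivAt ψ (Q t * angleForm t (ψ t)) t) →
      (∀ t ≤ T, κ' * sechSq t ≤ Q t) → (∀ t ≤ T, Q t ≤ κ'' * sechSq t) →
      Tendsto ψ atBot (𝓝 0) → k * π ≤ ψ T := by
  have h := isLinSol_legendrePair k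
  obtain ⟨t₀, d, hd, H⟩ := exists_phase_gap (κ'' := κ'') (by positivity) hκ'
  have h1 := h.tendsto_phase_atTop.eventually_const_lt
    (show (k : ℝ) * π - d < _ by linarith [le_totalPhase_legendrePair k])
  obtain ⟨T, hT, hT0⟩ := (h1.and (eventually_ge_atTop t₀)).exists
  refine ⟨T, fun ψ Q hψ hQ1 hQ2 hψ0 => ?_⟩
  have := H T hT0 _ ψ Q (fun t _ => h.hasDerivAt_phase' t) hψ hQ1 hQ2 h.tendsto_phase_atBot hψ0
  linarith

/-! ### The radial Cauchy problem at the origin -/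

/-- The vector field satisfied by `(f - log r * p, p)` when `r f' = p` and `p' = -r N(r, f)`. -/
def radialField (N : ℝ → ℝ → ℝ) (r : ℝ) (V : ℝ × ℝ) : ℝ × ℝ :=
  (r * log r * N r (V.1 + log r * V.2), -(r * N r (V.1 + log r * V.2)))

/-- Continuous sources, bounded and Lipschitz in the unknown, locally uniformly in `r`. -/
structure IsTameSource (N : ℝ → ℝ → ℝ) : Prop where
  cont : Continuous (Function.uncurry N)
  lip : ∀ R, ∃ K ≥ 0, ∀ r ∈ Icc 0 R, ∀ x y, |N r x - N r y| ≤ K * |x - y|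
  bdd : ∀ R, ∃ L ≥ 0, ∀ r ∈ Icc 0 R, ∀ x, |N r x| ≤ L

lemma exists_mul_log_bound (R : ℝ) : ∃ D ≥ 0, ∀ r ∈ Icc 0 R,
    r ≤ D ∧ r * |log r| ≤ D ∧ r * log r ^ 2 ≤ D := by
  have h1 : Continuous fun r : ℝ => |r * log r| := continuous_mul_log.abs
  have h2 : Continuous fun r : ℝ => 4 * (√r * log √r) ^ 2 := by
    have := (continuous_mul_log.comp continuous_sqrt).pow 2
    exact continuous_const.mul this
  obtain ⟨D, hD⟩ := (isCompact_Icc (a := (0 : ℝ)) (b := R)).exists_bound_of_continuousOn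
    ((continuous_abs.add (h1.add h2)).continuousOn)
  refine ⟨max D 0, le_max_right _ _, fun r hr => ?_⟩
  have h3 : |r| + (|r * log r| + 4 * (√r * log √r) ^ 2) ≤ D :=
    (le_abs_self _).trans (hD r hr)
  have h4 : 4 * (√r * log √r) ^ 2 = r * log r ^ 2 := by
    rw [mul_pow, sq_sqrt hr.1, log_sqrt hr.1]; ring
  rw [h4, abs_mul, abs_of_nonneg hr.1] at h3
  have h5 : 0 ≤ r * |log r| := mul_nonneg hr.1 (abs_nonneg _)
  have h6 : 0 ≤ r * log r ^ 2 := mul_nonneg hr.1 (sq_nonneg _)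
  have h7 := le_max_left D 0
  have h8 := hr.1
  refine ⟨?_, ?_, ?_⟩ <;> linarith

namespace IsTameSource

variable {N : ℝ → ℝ → ℝ}

lemma exists_lipschitz (hN : IsTameSource N) (R : ℝ) :
    ∃ K : ℝ≥0, ∀ r ∈ Icc 0 R, LipschitzWith K (radialField N r) := by
  obtain ⟨K, hK0, hK⟩ := hN.lip R
  obtain ⟨D, hD0, hD⟩ := exists_mul_log_bound R
  refine ⟨⟨4 * (D * K), by positivity⟩, fun r hr => LipschitzWith.of_dist_le_mul fun V V' => ?_⟩
  obtain ⟨d1, d2, d3⟩ := hD r hr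
  have hr0 := hr.1
  set x := V.1 + log r * V.2
  set x' := V'.1 + log r * V'.2
  have h1 : |x - x'| ≤ (1 + |log r|) * dist V V' := by
    have e : x - x' = (V.1 - V'.1) + log r * (V.2 - V'.2) := by simp only [x, x']; ring
    rw [e]
    refine (abs_add_le _ _).trans ?_
    rw [abs_mul, Prod.dist_eq, dist_eq, dist_eq, add_mul, one_mul]
    exact add_le_add (le_max_left _ _)
      (mul_le_mul_of_nonneg_left (le_max_right _ _) (abs_nonneg _))
  have h2 := (hK r hr x x').trans (mul_le_mul_of_nonneg_left h1 hK0)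
  have hl := abs_nonneg (log r)
  have hd : 0 ≤ dist V V' := dist_nonneg
  have hKd := mul_nonneg hK0 hd
  have h3 : r * (1 + |log r|) * |N r x - N r x'| ≤ 4 * (D * K) * dist V V' := by
    have h4 : r * (1 + |log r|) * (1 + |log r|) ≤ 4 * D := by
      have := sq_abs (log r)
      nlinarith
    calc r * (1 + |log r|) * |N r x - N r x'|
        ≤ r * (1 + |log r|) * (K * ((1 + |log r|) * dist V V')) :=
          mul_le_mul_of_nonneg_left h2 (by positivity)
      _ = r * (1 + |log r|) * (1 + |log r|) * (K * dist V V') := by ring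
      _ ≤ 4 * D * (K * dist V V') := mul_le_mul_of_nonneg_right h4 hKd
      _ = _ := by ring
  have hn := abs_nonneg (N r x - N r x')
  refine le_trans ?_ h3
  rw [Prod.dist_eq, dist_eq, dist_eq]
  refine max_le ?_ ?_
  · simp only [radialField]
    rw [← mul_sub, abs_mul, abs_mul, abs_of_nonneg hr0]
    refine mul_le_mul_of_nonneg_right ?_ hn
    nlinarith
  · simp only [radialField]
    rw [← neg_sub', ← mul_sub, abs_neg, abs_mul, abs_of_nonneg hr0]
    refine mul_le_mul_of_nonneg_right ?_ hn
    nlinarith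

lemma exists_norm_le (hN : IsTameSource N) (R : ℝ) :
    ∃ L : ℝ≥0, ∀ r ∈ Icc 0 R, ∀ V, ‖radialField N r V‖ ≤ L := by
  obtain ⟨L, hL0, hL⟩ := hN.bdd R
  obtain ⟨D, hD0, hD⟩ := exists_mul_log_bound R
  refine ⟨⟨D * L, by positivity⟩, fun r hr V => ?_⟩
  obtain ⟨d1, d2, d3⟩ := hD r hr
  have hr0 := hr.1
  have h := hL r hr (V.1 + log r * V.2)
  rw [Prod.norm_def]
  refine max_le ?_ ?_
  · simp only [radialField, norm_eq_abs]
    rw [abs_mul, abs_mul, abs_of_nonneg hr0]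
    exact mul_le_mul d2 h (abs_nonneg _) hD0
  · simp only [radialField, norm_eq_abs]
    rw [abs_neg, abs_mul, abs_of_nonneg hr0]
    exact mul_le_mul d1 h (abs_nonneg _) hD0

lemma continuousOn_radialField (hN : IsTameSource N) (V : ℝ × ℝ) :
    ContinuousOn (fun r => radialField N r V) (Ici 0) := by
  intro r hr
  rcases eq_or_lt_of_le (mem_Ici.1 hr) with rfl | h
  · have h0 : radialField N 0 V = 0 := by simp [radialField]
    obtain ⟨L, hL0, hL⟩ := hN.bdd 1
    rw [ContinuousWithinAt, h0]
    refine squeeze_zero_norm' (a := fun r => |r * log r| * L + |r| * L) ?_ ?_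
    · have h1 : ∀ᶠ r in 𝓝[Ici 0] (0:ℝ), r ∈ Icc (0:ℝ) 1 :=
        Icc_mem_nhdsGE (by norm_num)
      filter_upwards [h1] with r hr
      have h := hL r hr (V.1 + log r * V.2)
      have e1 : 0 ≤ |r * log r| * L := by positivity
      have e2 : 0 ≤ |r| * L := by positivity
      rw [Prod.norm_def]
      simp only [radialField, norm_eq_abs]
      rw [abs_mul (r * log r), abs_neg, abs_mul r (N _ _)]
      have e3 := mul_le_mul_of_nonneg_left h (abs_nonneg (r * log r))
      have e4 := mul_le_mul_of_nonneg_left h (abs_nonneg r)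
      exact max_le (by linarith) (by linarith)
    · have : Continuous fun r : ℝ => |r * log r| * L + |r| * L :=
        (continuous_mul_log.abs.mul continuous_const).add (continuous_abs.mul continuous_const)
      have := this.tendsto 0
      simp only [zero_mul, abs_zero, add_zero] at this
      exact this.mono_left nhdsWithin_le_nhds
  · have hlog : ContinuousAt log r := continuousAt_log h.ne'
    have hx : ContinuousAt (fun r => N r (V.1 + log r * V.2)) r :=
      ContinuousAt.comp (g := Function.uncurry N) (f := fun r => (r, V.1 + log r * V.2))
        hN.cont.continuousAt (continuousAt_id.prodMk
          (continuousAt_const.add (hlog.mul continuousAt_const)))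
    exact (((continuousAt_id.mul hlog).mul hx).prodMk
      ((continuousAt_id.mul hx).neg)).continuousWithinAt

lemma exists_on_Icc (hN : IsTameSource N) (V₀ : ℝ × ℝ) {R : ℝ} (hR : 0 ≤ R) :
    ∃ V : ℝ → ℝ × ℝ, V 0 = V₀ ∧
      ∀ r ∈ Icc 0 R, HasDerivWithinAt V (radialField N r (V r)) (Icc 0 R) r := by
  obtain ⟨K, hK⟩ := hN.exists_lipschitz R
  obtain ⟨L, hL⟩ := hN.exists_norm_le R
  have h : IsPicardLindelof (radialField N) (tmin := 0) (tmax := R) ⟨0, le_rfl, hR⟩ V₀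
      (L * ⟨R, hR⟩) 0 L K :=
    { lipschitzOnWith := fun t ht => (hK t ht).lipschitzOnWith
      continuousOn := fun V _ => (hN.continuousOn_radialField V).mono Icc_subset_Ici_self
      norm_le := fun t ht V _ => hL t ht V
      mul_max_le := by simp [hR]; exact le_rfl }
  exact h.exists_eq_forall_mem_Icc_hasDerivWithinAt₀

lemma exists_dist_le (hN : IsTameSource N) (R : ℝ) : ∃ K ≥ 0, ∀ R' ≤ R, ∀ V V' : ℝ → ℝ × ℝ,
    (∀ r ∈ Icc 0 R', HasDerivWithinAt V (radialField N r (V r)) (Icc 0 R') r) →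
    (∀ r ∈ Icc 0 R', HasDerivWithinAt V' (radialField N r (V' r)) (Icc 0 R') r) →
    ∀ r ∈ Icc 0 R', dist (V r) (V' r) ≤ K * dist (V 0) (V' 0) := by
  obtain ⟨K, hK⟩ := hN.exists_lipschitz R
  refine ⟨exp (K * R), by positivity, fun R' hR' V V' hV hV' r hr => ?_⟩
  have hd : ∀ V : ℝ → ℝ × ℝ,
      (∀ r ∈ Icc 0 R', HasDerivWithinAt V (radialField N r (V r)) (Icc 0 R') r) →
      ∀ r ∈ Ico 0 R', HasDerivWithinAt V (radialField N r (V r)) (Ici r) r := fun V hV r hr =>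
    (hV r (Ico_subset_Icc_self hr)).mono_of_mem_nhdsWithin (Icc_mem_nhdsGE_of_mem hr)
  have := dist_le_of_trajectories_ODE_of_mem (K := K) (v := radialField N) (s := fun _ => univ)
    (δ := dist (V 0) (V' 0))
    (fun t ht => (hK t ⟨ht.1, ht.2.le.trans hR'⟩).lipschitzOnWith)
    (fun r hr => (hV r hr).continuousWithinAt) (hd V hV) (fun _ _ => trivial)
    (fun r hr => (hV' r hr).continuousWithinAt) (hd V' hV') (fun _ _ => trivial) le_rfl r hr
  rw [mul_comm]
  refine this.trans (mul_le_mul_of_nonneg_left (exp_le_exp.2 ?_) dist_nonneg)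
  exact mul_le_mul_of_nonneg_left (by linarith [hr.2]) K.2

lemma exists_global (hN : IsTameSource N) (V₀ : ℝ × ℝ) :
    ∃ V : ℝ → ℝ × ℝ, V 0 = V₀ ∧
      ∀ r ∈ Ici (0 : ℝ), HasDerivWithinAt V (radialField N r (V r)) (Ici 0) r := by
  choose U hU0 hU using fun n : ℕ => hN.exists_on_Icc V₀ (Nat.cast_nonneg (α := ℝ) n)
  have huniq : ∀ n m : ℕ, ∀ r ∈ Icc (0 : ℝ) n, n ≤ m → U m r = U n r := by
    intro n m r hr hnm
    obtain ⟨K, -, hK⟩ := hN.exists_dist_le n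
    have hsub : Icc (0 : ℝ) n ⊆ Icc 0 m := Icc_subset_Icc_right (by exact_mod_cast hnm)
    have := hK n le_rfl (U m) (U n) (fun s hs => (hU m s (hsub hs)).mono hsub) (hU n) r hr
    rw [hU0, hU0, dist_self, mul_zero] at this
    exact dist_le_zero.1 this
  set V : ℝ → ℝ × ℝ := fun r => U (⌈r⌉₊ + 1) r with hV
  have hVU : ∀ n : ℕ, ∀ r ∈ Icc (0 : ℝ) n, V r = U n r := by
    intro n r hr
    have hr' : r ∈ Icc (0 : ℝ) (⌈r⌉₊ + 1 : ℕ) :=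
      ⟨hr.1, (Nat.le_ceil r).trans (by push_cast; linarith)⟩
    rcases le_total n (⌈r⌉₊ + 1) with h | h
    · exact huniq _ _ r hr h
    · exact (huniq _ _ r hr' h).symm
  refine ⟨V, by simp [hV, hU0], fun r hr => ?_⟩
  obtain ⟨n, hn⟩ := exists_nat_gt r
  have hr' : r ∈ Icc (0 : ℝ) n := ⟨hr, hn.le⟩
  have h1 := (hU n r hr').congr (fun s hs => hVU n s hs) (hVU n r hr')
  rw [← hVU n r hr'] at h1
  refine h1.mono_of_mem_nhdsWithin ?_
  rw [← Ici_inter_Iic]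
  exact inter_mem_nhdsWithin _ (Iic_mem_nhds hn)

end IsTameSource

/-! ### The family of radial solutions -/

/-- The nonlinearity, truncated above a barrier that solutions with `f 0 ≤ B` never cross. -/
def truncSource (μ B r x : ℝ) : ℝ :=
  μ / (1 + r ^ 2) ^ 2 * (exp (2 * min x (B + μ / 4 * log (1 + r ^ 2))) - 1)

lemma abs_exp_two_mul_sub_le {M u v : ℝ} (hu : u ≤ M) (hv : v ≤ M) :
    |exp (2 * u) - exp (2 * v)| ≤ 2 * exp (2 * M) * |u - v| := by
  wlog h : v ≤ u generalizing u v
  · rw [abs_sub_comm, abs_sub_comm u]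
    exact this hv hu (le_of_not_ge h)
  rw [abs_of_nonneg (sub_nonneg.2 (exp_le_exp.2 (by linarith))), abs_of_nonneg (sub_nonneg.2 h)]
  have h1 : exp (2 * v) = exp (2 * u) * exp (2 * (v - u)) := by rw [← exp_add]; ring_nf
  have h2 := add_one_le_exp (2 * (v - u))
  have h3 : exp (2 * u) ≤ exp (2 * M) := exp_le_exp.2 (by linarith)
  have h4 := exp_pos (2 * u)
  rw [h1]
  nlinarith

lemma isTameSource_truncSource {μ : ℝ} (hμ : 0 < μ) (B : ℝ) :
    IsTameSource (truncSource μ B) := by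
  have hpos : ∀ r : ℝ, 0 < 1 + r ^ 2 := fun r => by positivity
  have hμ' : ∀ r : ℝ, 0 ≤ μ / (1 + r ^ 2) ^ 2 ∧ μ / (1 + r ^ 2) ^ 2 ≤ μ := fun r =>
    ⟨by positivity, div_le_self hμ.le (one_le_pow₀ (by nlinarith [sq_nonneg r]))⟩
  have hM : ∀ R : ℝ, ∀ r ∈ Icc 0 R, B + μ / 4 * log (1 + r ^ 2) ≤ B + μ / 4 * log (1 + R ^ 2) :=
    fun R r hr => by
      have : log (1 + r ^ 2) ≤ log (1 + R ^ 2) :=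
        log_le_log (hpos r) (by nlinarith [hr.1, hr.2])
      nlinarith
  refine ⟨?_, fun R => ?_, fun R => ?_⟩
  · have h1 : Continuous fun q : ℝ × ℝ => 1 + q.1 ^ 2 := by fun_prop
    have h2 : Continuous fun q : ℝ × ℝ => log (1 + q.1 ^ 2) := h1.log fun q => (hpos q.1).ne'
    have h3 : Continuous fun q : ℝ × ℝ => μ / (1 + q.1 ^ 2) ^ 2 :=
      continuous_const.div (h1.pow 2) fun q => (pow_pos (hpos q.1) 2).ne'
    exact h3.mul ((continuous_exp.comp (continuous_const.mul (continuous_snd.min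
      (continuous_const.add (continuous_const.mul h2))))).sub continuous_const)
  · set M := B + μ / 4 * log (1 + R ^ 2)
    refine ⟨μ * (2 * exp (2 * M)), by positivity, fun r hr x y => ?_⟩
    have h1 := abs_exp_two_mul_sub_le ((min_le_right x _).trans (hM R r hr))
      ((min_le_right y _).trans (hM R r hr))
    have h2 := abs_min_sub_min_le_max x (B + μ / 4 * log (1 + r ^ 2)) y
      (B + μ / 4 * log (1 + r ^ 2))
    rw [sub_self, abs_zero, max_eq_left (abs_nonneg _)] at h2
    unfold truncSource
    rw [← mul_sub, sub_sub_sub_cancel_right, abs_mul, abs_of_nonneg (hμ' r).1, mul_assoc]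
    refine mul_le_mul (hμ' r).2 (h1.trans ?_) (abs_nonneg _) hμ.le
    exact mul_le_mul_of_nonneg_left h2 (by positivity)
  · set M := B + μ / 4 * log (1 + R ^ 2)
    refine ⟨μ * (exp (2 * M) + 1), by positivity, fun r hr x => ?_⟩
    unfold truncSource
    rw [abs_mul, abs_of_nonneg (hμ' r).1]
    refine mul_le_mul (hμ' r).2 ?_ (abs_nonneg _) hμ.le
    refine (abs_sub _ _).trans ?_
    rw [abs_one, abs_of_pos (exp_pos _)]
    have : exp (2 * min x (B + μ / 4 * log (1 + r ^ 2))) ≤ exp (2 * M) :=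
      exp_le_exp.2 (mul_le_mul_of_nonneg_left ((min_le_right _ _).trans (hM R r hr)) zero_le_two)
    linarith

/-- `f` is the radial solution with `f 0 = a` and `p = r f'`. -/
structure IsRadialSol (μ a : ℝ) (f p : ℝ → ℝ) : Prop where
  deriv_fst : ∀ r > 0, HasDerivAt f (p r / r) r
  deriv_snd : ∀ r > 0, HasDerivAt p (-(μ * r / (1 + r ^ 2) ^ 2 * (exp (2 * f r) - 1))) r
  fst_zero : f 0 = a
  cont_zero : Tendsto f (𝓝[>] 0) (𝓝 a)
  bound_snd : ∀ R, ∃ C ≥ 0, ∀ r ∈ Icc 0 R, |p r| ≤ C * r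

lemma hasDerivAt_barrier (μ r : ℝ) : HasDerivAt (fun r => μ / (2 * (1 + r ^ 2)))
    (-(μ * r / (1 + r ^ 2) ^ 2)) r := by
  have h1 : HasDerivAt (fun r : ℝ => 2 * (1 + r ^ 2)) (2 * (2 * r)) r := by
    simpa using ((hasDerivAt_pow 2 r).const_add 1).const_mul 2
  have h2 : (2 * (1 + r ^ 2)) ≠ 0 := by positivity
  exact ((hasDerivAt_const r μ).div h1 h2).congr_deriv (by field_simp; ring)

lemma hasDerivAt_log_barrier (μ r : ℝ) : HasDerivAt (fun r => μ / 4 * log (1 + r ^ 2))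
    (μ / 4 * (2 * r / (1 + r ^ 2))) r := by
  have h1 : HasDerivAt (fun r : ℝ => 1 + r ^ 2) (2 * r) r := by
    simpa using (hasDerivAt_pow 2 r).const_add 1
  exact (h1.log (by positivity)).const_mul (μ / 4)

lemma exists_radial_family {μ B : ℝ} (hμ : 0 < μ) (hB : 0 ≤ B) :
    ∃ f p : ℝ → ℝ → ℝ, (∀ a ≤ B, IsRadialSol μ a (f a) (p a)) ∧
      (∀ R, ∃ C ≥ 0, ∀ a ≤ B, ∀ b ≤ B, ∀ r ∈ Icc 0 R,
        |f a r - f b r| ≤ C * |a - b| ∧ |p a r - p b r| ≤ C * |a - b| * r) ∧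
      (∀ r ≥ 0, f 0 r = 0) := by
  have hN := isTameSource_truncSource hμ B
  choose V hV0 hV using fun a : ℝ => hN.exists_global (a, 0)
  set f : ℝ → ℝ → ℝ := fun a r => (V a r).1 + log r * (V a r).2 with hf
  set p : ℝ → ℝ → ℝ := fun a r => (V a r).2 with hp
  have hVat : ∀ a, ∀ r > 0, HasDerivAt (V a) (radialField (truncSource μ B) r (V a r)) r :=
    fun a r hr => (hV a r hr.le).hasDerivAt (Ici_mem_nhds hr)
  have hpd : ∀ a, ∀ r > 0, HasDerivAt (p a) (-(r * truncSource μ B r (f a r))) r := fun a r hr =>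
    (hVat a r hr).snd
  have hfd : ∀ a, ∀ r > 0, HasDerivAt (f a) (p a r / r) r := fun a r hr => by
    have h1 : HasDerivAt (fun r => (V a r).1) (radialField (truncSource μ B) r (V a r)).1 r :=
      (hVat a r hr).fst
    exact (h1.add ((hasDerivAt_log hr.ne').mul (hpd a r hr))).congr_deriv (by
      simp only [radialField, hp, hf]; field_simp; ring)
  have hdist : ∀ R, ∃ K ≥ 0, ∀ a b, ∀ r ∈ Icc 0 R, dist (V a r) (V b r) ≤ K * |a - b| := by
    intro R
    obtain ⟨K, hK0, hK⟩ := hN.exists_dist_le R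
    refine ⟨K, hK0, fun a b r hr => ?_⟩
    have := hK R le_rfl (V a) (V b) (fun s hs => (hV a s hs.1).mono Icc_subset_Ici_self)
      (fun s hs => (hV b s hs.1).mono Icc_subset_Ici_self) r hr
    rw [hV0, hV0] at this
    simpa [Prod.dist_eq, dist_eq] using this
  have hpc : ∀ a, ContinuousOn (p a) (Ici 0) := fun a r hr =>
    (hV a r hr).continuousWithinAt.snd
  have hp0 : ∀ a, p a 0 = 0 := fun a => by simp [hp, hV0]
  -- Lipschitz dependence on the initial value
  have hlip : ∀ R, ∃ C ≥ 0, ∀ a b, ∀ r ∈ Icc 0 R,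
      |f a r - f b r| ≤ C * |a - b| ∧ |p a r - p b r| ≤ C * |a - b| * r := by
    intro R
    obtain ⟨K, hK0, hK⟩ := hdist R
    obtain ⟨D, hD0, hD⟩ := exists_mul_log_bound R
    obtain ⟨S, hS0, hS⟩ := hN.lip R
    have hVd : ∀ a b, ∀ r ∈ Icc 0 R, |(V a r).1 - (V b r).1| ≤ K * |a - b| ∧
        |(V a r).2 - (V b r).2| ≤ K * |a - b| := by
      intro a b r hr
      have h1 := hK a b r hr
      rw [Prod.dist_eq, dist_eq, dist_eq] at h1
      exact max_le_iff.1 h1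
    have hfsub : ∀ a b r, f a r - f b r
        = ((V a r).1 - (V b r).1) + log r * ((V a r).2 - (V b r).2) := fun a b r => by
      simp only [hf]; ring
    set C₁ := S * (2 * D * K) with hC₁
    have hC₁0 : 0 ≤ C₁ := by positivity
    have hpdiff : ∀ a b, ∀ r ∈ Icc 0 R, |p a r - p b r| ≤ C₁ * |a - b| * r := by
      intro a b r hr
      have hderiv : ∀ s ∈ Ico 0 R, HasDerivWithinAt (fun s => p a s - p b s)
          (-(s * truncSource μ B s (f a s)) - -(s * truncSource μ B s (f b s))) (Ici s) s := by
        intro s hs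
        have hmono : Ici s ⊆ Ici 0 := Ici_subset_Ici.2 hs.1
        have h1 : ∀ a, HasDerivWithinAt (p a) (-(s * truncSource μ B s (f a s))) (Ici s) s :=
          fun a => ((hV a s hs.1).mono hmono).snd
        exact (h1 a).sub (h1 b)
      have := norm_image_sub_le_of_norm_deriv_right_le_segment (a := 0) (b := R)
        (f := fun s => p a s - p b s) (C := C₁ * |a - b|)
        (((hpc a).sub (hpc b)).mono Icc_subset_Ici_self) hderiv (fun s hs => ?_) r hr
      · simpa [hp0] using this
      · obtain ⟨d1, d2, -⟩ := hD s (Ico_subset_Icc_self hs)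
        obtain ⟨v1, v2⟩ := hVd a b s (Ico_subset_Icc_self hs)
        have h1 := hS s (Ico_subset_Icc_self hs) (f a s) (f b s)
        have h2 : s * |f a s - f b s| ≤ 2 * D * K * |a - b| := by
          rw [hfsub]
          refine (mul_le_mul_of_nonneg_left (abs_add_le _ _) hs.1).trans ?_
          rw [abs_mul, mul_add, ← mul_assoc]
          have e1 := mul_le_mul d1 v1 (abs_nonneg _) hD0
          have e2 := mul_le_mul d2 v2 (abs_nonneg _) hD0
          linarith
        have e : -(s * truncSource μ B s (f a s)) - -(s * truncSource μ B s (f b s))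
          = -(s * (truncSource μ B s (f a s) - truncSource μ B s (f b s))) := by ring
        rw [norm_eq_abs, e, abs_neg, abs_mul, abs_of_nonneg hs.1]
        have h3 := mul_le_mul_of_nonneg_left h1 hs.1
        have h4 := mul_le_mul_of_nonneg_left h2 hS0
        calc _ ≤ _ := h3
          _ = S * (s * |f a s - f b s|) := by ring
          _ ≤ _ := h4
          _ = _ := by rw [hC₁]; ring
    refine ⟨K + C₁ * D + C₁, by positivity, fun a b r hr => ?_⟩
    obtain ⟨d1, d2, -⟩ := hD r hr
    have hab := abs_nonneg (a - b)
    have h1 := hpdiff a b r hr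
    constructor
    · rw [hfsub]
      refine (abs_add_le _ _).trans ?_
      rw [abs_mul]
      have h2 := mul_le_mul_of_nonneg_left h1 (abs_nonneg (log r))
      have h3 := mul_le_mul_of_nonneg_left d2 (mul_nonneg hC₁0 hab)
      have h4 := (hVd a b r hr).1
      have h5 := mul_nonneg hC₁0 hab
      have h6 : |log r| * |(V a r).2 - (V b r).2| ≤ |log r| * (C₁ * |a - b| * r) := h2
      nlinarith
    · refine h1.trans (mul_le_mul_of_nonneg_right ?_ hr.1)
      have : 0 ≤ C₁ * D := by positivity
      nlinarith
  -- the trivial solution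
  have hVz : ∀ r ≥ 0, V 0 r = 0 := by
    intro r hr
    obtain ⟨K, -, hK⟩ := hN.exists_dist_le r
    have hz : ∀ s, radialField (truncSource μ B) s 0 = 0 := fun s => by
      have : 0 ≤ B + μ / 4 * log (1 + s ^ 2) := by
        have := log_nonneg (by nlinarith [sq_nonneg s] : 1 ≤ 1 + s ^ 2)
        positivity
      simp [radialField, truncSource, min_eq_left this]
    have := hK r le_rfl (V 0) (fun _ => 0)
      (fun s hs => (hV 0 s hs.1).mono Icc_subset_Ici_self)
      (fun s hs => (hasDerivWithinAt_const s _ _).congr_deriv (hz s).symm) r ⟨hr, le_rfl⟩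
    rw [hV0] at this
    simpa using this
  have hfz : ∀ r ≥ 0, f 0 r = 0 := fun r hr => by simp [hf, hVz r hr]
  have hpz : ∀ r ≥ 0, p 0 r = 0 := fun r hr => by simp [hp, hVz r hr]
  have hpb : ∀ a R, ∃ C ≥ 0, ∀ r ∈ Icc 0 R, |p a r| ≤ C * r := by
    intro a R
    obtain ⟨C, hC0, hC⟩ := hlip R
    refine ⟨C * |a|, by positivity, fun r hr => ?_⟩
    have := (hC a 0 r hr).2
    rwa [hpz r hr.1, sub_zero, sub_zero] at this
  have hfc : ∀ a, Tendsto (f a) (𝓝[>] 0) (𝓝 a) := by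
    intro a
    obtain ⟨C, hC0, hC⟩ := hpb a 1
    have h1 : Tendsto (fun r => (V a r).1) (𝓝[>] 0) (𝓝 a) := by
      have : ContinuousWithinAt (fun r => (V a r).1) (Ici 0) 0 :=
        (hV a 0 (mem_Ici.2 le_rfl)).continuousWithinAt.fst
      have h := this.tendsto.mono_left (nhdsWithin_mono 0 Ioi_subset_Ici_self)
      rwa [hV0] at h
    have h2 : Tendsto (fun r => log r * (V a r).2) (𝓝[>] 0) (𝓝 0) := by
      refine squeeze_zero_norm' (a := fun r => C * |r * log r|) ?_ ?_
      · filter_upwards [Ioc_mem_nhdsGT (zero_lt_one (α := ℝ))] with r hr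
        rw [norm_eq_abs, abs_mul, abs_mul, abs_of_pos hr.1]
        have := mul_le_mul_of_nonneg_left (hC r ⟨hr.1.le, hr.2⟩) (abs_nonneg (log r))
        have e : |(V a r).2| = |p a r| := rfl
        rw [e]
        linarith
      · have := (continuous_mul_log.abs.const_mul C).tendsto 0
        simp only [zero_mul, abs_zero, mul_zero] at this
        exact this.mono_left nhdsWithin_le_nhds
    simpa using h1.add h2
  -- the truncation is inactive
  have hbar : ∀ a ≤ B, ∀ r > 0, f a r ≤ B + μ / 4 * log (1 + r ^ 2) := by
    intro a ha r hr
    have hp1 : ∀ s > 0, p a s ≤ μ / 2 - μ / (2 * (1 + s ^ 2)) := by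
      intro s hs
      have hmono : AntitoneOn (fun s => p a s + μ / (2 * (1 + s ^ 2))) (Ici 0) := by
        refine antitoneOn_of_hasDerivWithinAt_nonpos (convex_Ici 0)
          (f' := fun s => -(s * truncSource μ B s (f a s)) + -(μ * s / (1 + s ^ 2) ^ 2))
          ((hpc a).add (fun s _ => (hasDerivAt_barrier μ s).continuousAt.continuousWithinAt))
          (fun s hs => ?_) (fun s hs => ?_)
        · rw [interior_Ici] at hs
          exact ((hpd a s hs).add (hasDerivAt_barrier μ s)).hasDerivWithinAt
        · rw [interior_Ici] at hs
          have hs' := mem_Ioi.1 hs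
          have e : -(s * truncSource μ B s (f a s)) + -(μ * s / (1 + s ^ 2) ^ 2)
            = -(μ * s / (1 + s ^ 2) ^ 2 *
              exp (2 * min (f a s) (B + μ / 4 * log (1 + s ^ 2)))) := by
            unfold truncSource; ring
          rw [e]
          have : 0 ≤ μ * s / (1 + s ^ 2) ^ 2 := by positivity
          nlinarith [mul_nonneg this
            (exp_pos (2 * min (f a s) (B + μ / 4 * log (1 + s ^ 2)))).le]
      have := hmono (mem_Ici.2 le_rfl) (mem_Ici.2 hs.le) hs.le
      simp only [hp0] at this
      norm_num at this
      linarith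
    have hanti : AntitoneOn (fun s => f a s - μ / 4 * log (1 + s ^ 2)) (Ioi 0) := by
      refine antitoneOn_of_hasDerivWithinAt_nonpos (convex_Ioi 0)
        (f' := fun s => p a s / s - μ / 4 * (2 * s / (1 + s ^ 2)))
        (fun s hs => ((hfd a s hs).sub
          (hasDerivAt_log_barrier μ s)).continuousAt.continuousWithinAt)
        (fun s hs => ?_) (fun s hs => ?_)
      · rw [interior_Ioi] at hs
        exact ((hfd a s hs).sub (hasDerivAt_log_barrier μ s)).hasDerivWithinAt
      · rw [interior_Ioi] at hs
        have hs' := mem_Ioi.1 hs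
        have h1 := hp1 s hs
        rw [sub_nonpos, div_le_iff₀ hs']
        refine h1.trans (le_of_eq ?_)
        have : 1 + s ^ 2 ≠ 0 := by positivity
        field_simp
        ring
    have hlim : Tendsto (fun s => f a s - μ / 4 * log (1 + s ^ 2)) (𝓝[>] 0) (𝓝 (a - 0)) := by
      refine (hfc a).sub ?_
      have := (hasDerivAt_log_barrier μ 0).continuousAt.tendsto
      norm_num at this
      exact this.mono_left nhdsWithin_le_nhds
    have h1 : f a r - μ / 4 * log (1 + r ^ 2) ≤ a - 0 := by
      refine ge_of_tendsto hlim ?_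
      filter_upwards [Ioc_mem_nhdsGT hr] with s hs
      exact hanti hs.1 hr hs.2
    linarith
  refine ⟨f, p, fun a ha => ⟨hfd a, fun r hr => ?_, by simp [hf, hV0], hfc a, hpb a⟩,
    fun R => ?_, hfz⟩
  · refine (hpd a r hr).congr_deriv ?_
    unfold truncSource
    rw [min_eq_left (hbar a ha r hr)]
    ring
  · obtain ⟨C, hC0, hC⟩ := hlip R
    exact ⟨C, hC0, fun a _ b _ r hr => hC a b r hr⟩

/-! ### Solutions in the logarithmic variable -/

/-- The radial equation in the variable `t = log r`, for `g t = f (exp t)` and `G = g'`. -/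
structure IsLogSol (μ a : ℝ) (g G : ℝ → ℝ) : Prop where
  deriv_fst : ∀ t, HasDerivAt g (G t) t
  deriv_snd : ∀ t, HasDerivAt G (-(μ / 4 * sechSq t * (exp (2 * g t) - 1))) t
  lim_fst : Tendsto g atBot (𝓝 a)
  bound_snd : ∀ T, ∃ C ≥ 0, ∀ t ≤ T, |G t| ≤ C * exp t

lemma IsRadialSol.isLogSol {μ a : ℝ} {f p : ℝ → ℝ} (h : IsRadialSol μ a f p) :
    IsLogSol μ a (fun t => f (exp t)) (fun t => p (exp t)) where
  deriv_fst t := ((h.deriv_fst _ (exp_pos t)).comp t (hasDerivAt_exp t)).congr_deriv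
    (div_mul_cancel₀ _ (exp_pos t).ne')
  deriv_snd t := ((h.deriv_snd _ (exp_pos t)).comp t (hasDerivAt_exp t)).congr_deriv (by
    have h1 : exp (2 * t) = exp t ^ 2 := by rw [← exp_nat_mul]; norm_num
    rw [sechSq, h1]
    field_simp)
  lim_fst := h.cont_zero.comp (tendsto_exp_atBot_nhdsGT)
  bound_snd T := by
    obtain ⟨C, hC0, hC⟩ := h.bound_snd (exp T)
    exact ⟨C, hC0, fun t ht => hC _ ⟨(exp_pos t).le, exp_le_exp.2 ht⟩⟩

/-- The total mass of the weight on `[t, ∞)`. -/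
def tailMass (μ t : ℝ) : ℝ := μ / 4 * (1 - expTanh t)

lemma tailMass_eq (μ t : ℝ) : tailMass μ t = μ / 2 / (1 + exp (2 * t)) := by
  unfold tailMass expTanh; ring

lemma hasDerivAt_tailMass (μ t : ℝ) : HasDerivAt (tailMass μ) (-(μ / 4 * sechSq t)) t :=
  (((hasDerivAt_expTanh t).const_sub 1).const_mul (μ / 4)).congr_deriv (by ring)

lemma tailMass_pos {μ : ℝ} (hμ : 0 < μ) (t : ℝ) : 0 < tailMass μ t := by
  rw [tailMass_eq]; positivity

lemma tailMass_le_exp {μ : ℝ} (hμ : 0 < μ) (t : ℝ) : tailMass μ t ≤ μ / 2 * exp (-(2 * t)) := by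
  rw [tailMass_eq, exp_neg, ← div_eq_mul_inv]
  exact div_le_div_of_nonneg_left (by positivity) (exp_pos _) (by linarith)

lemma tendsto_tailMass_atBot (μ : ℝ) : Tendsto (tailMass μ) atBot (𝓝 (μ / 2)) := by
  have := (tendsto_expTanh_atBot.const_sub 1).const_mul (μ / 4)
  rw [show μ / 2 = μ / 4 * (1 - -1) by ring]
  exact this

lemma tendsto_tailMass_atTop (μ : ℝ) : Tendsto (tailMass μ) atTop (𝓝 0) := by
  have := (tendsto_expTanh_atTop.const_sub 1).const_mul (μ / 4)
  rw [sub_self, mul_zero] at this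
  exact this

/-- The divided difference `(exp (2 x) - 1) / x`. -/
def expSlope (x : ℝ) : ℝ := dslope (fun x => exp (2 * x)) 0 x

lemma continuous_expSlope : Continuous expSlope := by
  have hd : Differentiable ℝ fun x : ℝ => exp (2 * x) := by fun_prop
  refine continuous_iff_continuousAt.2 fun x => ?_
  unfold expSlope
  rcases eq_or_ne x 0 with rfl | h
  · exact continuousAt_dslope_same.2 (hd 0)
  · exact (continuousAt_dslope_of_ne h).2 hd.continuous.continuousAt

lemma expSlope_mul (x : ℝ) : expSlope x * x = exp (2 * x) - 1 := by
  have := sub_smul_dslope (fun x : ℝ => exp (2 * x)) 0 x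
  simp only [sub_zero, smul_eq_mul, mul_zero, exp_zero] at this
  unfold expSlope; linarith

lemma expSlope_zero : expSlope 0 = 2 := by
  unfold expSlope
  rw [dslope_same]
  exact ((hasDerivAt_exp_two_mul 0).congr_deriv (by simp)).deriv

lemma expSlope_pos (x : ℝ) : 0 < expSlope x := by
  have h := expSlope_mul x
  rcases lt_trichotomy x 0 with hx | rfl | hx
  · have : exp (2 * x) < 1 := exp_lt_one_iff.2 (by linarith)
    by_contra hn
    nlinarith
  · rw [expSlope_zero]; norm_num
  · have : 1 < exp (2 * x) := one_lt_exp_iff.2 (by linarith)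
    by_contra hn
    nlinarith

lemma expSlope_le {x M : ℝ} (hx : x ≤ M) (hM : 0 ≤ M) : expSlope x ≤ 2 * exp (2 * M) := by
  have h := abs_exp_two_mul_sub_le hx hM
  rw [mul_zero, exp_zero, ← expSlope_mul, sub_zero, abs_mul, abs_of_pos (expSlope_pos x)] at h
  rcases eq_or_ne x 0 with rfl | hx0
  · rw [expSlope_zero]
    linarith [one_le_exp (by linarith : 0 ≤ 2 * M)]
  · exact le_of_mul_le_mul_right h (abs_pos.2 hx0)

/-- The potential of the equation read as a linear equation for `g`. -/
def potential (μ : ℝ) (g : ℝ → ℝ) (t : ℝ) : ℝ := μ / 4 * sechSq t * expSlope (g t)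

lemma potential_mul (μ : ℝ) (g : ℝ → ℝ) (t : ℝ) :
    potential μ g t * g t = μ / 4 * sechSq t * (exp (2 * g t) - 1) := by
  rw [potential, mul_assoc, expSlope_mul]

lemma one_add_sq_sq_le_exp {δ t : ℝ} (hδ : 0 < δ) (ht : 0 ≤ t) :
    (1 + t ^ 2) ^ 2 ≤ (1 + 8 / δ ^ 2) ^ 2 * exp (δ * t) := by
  have h1 := quadratic_le_exp_of_nonneg (by positivity : 0 ≤ δ * t / 2)
  have h2 : 1 + t ^ 2 ≤ (1 + 8 / δ ^ 2) * exp (δ * t / 2) := by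
    have h3 : t ^ 2 ≤ 8 / δ ^ 2 * exp (δ * t / 2) := by
      rw [div_mul_eq_mul_div, le_div_iff₀ (by positivity)]
      nlinarith [mul_nonneg hδ.le ht]
    have h4 := one_le_exp (by positivity : 0 ≤ δ * t / 2)
    linarith
  calc (1 + t ^ 2) ^ 2 ≤ ((1 + 8 / δ ^ 2) * exp (δ * t / 2)) ^ 2 :=
        pow_le_pow_left₀ (by positivity) h2 2
    _ = _ := by rw [mul_pow, ← exp_nat_mul]; congr 2; push_cast; ring

lemma one_add_exp_eq (t : ℝ) : 2 * exp (2 * t) / (1 + exp (2 * t)) = 1 + expTanh t := by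
  have := exp_pos (2 * t)
  unfold expTanh; field_simp; ring

namespace IsLogSol

variable {μ a : ℝ} {g G : ℝ → ℝ}

lemma cont_fst (h : IsLogSol μ a g G) : Continuous g :=
  continuous_iff_continuousAt.2 fun t => (h.deriv_fst t).continuousAt

lemma cont_snd (h : IsLogSol μ a g G) : Continuous G :=
  continuous_iff_continuousAt.2 fun t => (h.deriv_snd t).continuousAt

lemma lim_snd (h : IsLogSol μ a g G) : Tendsto G atBot (𝓝 0) := by
  obtain ⟨C, -, hC⟩ := h.bound_snd 0
  refine squeeze_zero_norm' (a := fun t => C * exp t) ?_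
    (by simpa using tendsto_exp_atBot.const_mul C)
  filter_upwards [eventually_le_atBot 0] with t ht using hC t ht

lemma lim_intercept (h : IsLogSol μ a g G) : Tendsto (fun t => g t - t * G t) atBot (𝓝 a) := by
  obtain ⟨C, -, hC⟩ := h.bound_snd 0
  have h1 : Tendsto (fun t => t * G t) atBot (𝓝 0) := by
    refine squeeze_zero_norm' (a := fun t => |t * exp t| * C) ?_
      (by simpa using (tendsto_mul_exp_atBot.abs).mul_const C)
    filter_upwards [eventually_le_atBot 0] with t ht
    rw [norm_eq_abs, abs_mul, abs_mul, abs_of_pos (exp_pos t)]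
    have := mul_le_mul_of_nonneg_left (hC t ht) (abs_nonneg t)
    linarith
  simpa using h.lim_fst.sub h1

lemma hasDerivAt_add_tailMass (h : IsLogSol μ a g G) (t : ℝ) :
    HasDerivAt (fun t => G t + tailMass μ t) (-(μ / 4 * sechSq t * exp (2 * g t))) t :=
  ((h.deriv_snd t).add (hasDerivAt_tailMass μ t)).congr_deriv (by ring)

lemma antitone_add_tailMass (h : IsLogSol μ a g G) (hμ : 0 < μ) :
    Antitone fun t => G t + tailMass μ t :=
  antitone_of_hasDerivAt_nonpos h.hasDerivAt_add_tailMass fun t =>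
    neg_nonpos.2 (mul_nonneg (mul_nonneg (by positivity) (sechSq_pos t).le) (exp_pos _).le)

lemma add_tailMass_le (h : IsLogSol μ a g G) (hμ : 0 < μ) (t : ℝ) :
    G t + tailMass μ t ≤ μ / 2 := by
  have := (h.lim_snd.add (tendsto_tailMass_atBot μ))
  rw [zero_add] at this
  exact (h.antitone_add_tailMass hμ).ge_of_tendsto this t

lemma fst_le (h : IsLogSol μ a g G) (hμ : 0 < μ) (t : ℝ) :
    g t ≤ a + μ / 4 * log (1 + exp (2 * t)) := by
  have hd : ∀ s ≤ t, HasDerivAt (fun s => μ / 4 * log (1 + exp (2 * s)) - g s)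
      (μ / 4 * (1 + expTanh s) - G s) s := fun s _ => by
    have h1 := (((hasDerivAt_exp_two_mul s).const_add 1).log (by positivity)).const_mul (μ / 4)
    exact (h1.congr_deriv (by rw [one_add_exp_eq])).sub (h.deriv_fst s)
  have hl : Tendsto (fun s => μ / 4 * log (1 + exp (2 * s)) - g s) atBot (𝓝 (-a)) := by
    have h1 := ((tendsto_exp_two_mul_atBot.const_add 1).log (by norm_num)).const_mul (μ / 4)
    simpa using h1.sub h.lim_fst
  have := le_of_tendsto_atBot_of_hasDerivAt_nonneg hl hd (fun s _ => by
    have := h.add_tailMass_le hμ s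
    unfold tailMass at this
    linarith)
  linarith

lemma exists_add_tailMass_lt_one (h : IsLogSol μ a g G) (hμ : 0 < μ) :
    ∃ T ≥ 0, G T + tailMass μ T < 1 := by
  by_contra! hn
  have h1 : ∀ t ≥ 0, t + (g 0 - μ / 4) ≤ g t := by
    intro t ht
    have hd : ∀ s ∈ Icc 0 t, HasDerivAt (fun s => g s - s - μ / 4 * exp (-(2 * s)))
        (G s - 1 - μ / 4 * (exp (-(2 * s)) * (-(2 * 1)))) s := fun s _ =>
      ((h.deriv_fst s).sub (hasDerivAt_id s)).sub
        ((((hasDerivAt_id s).const_mul 2).neg.exp).const_mul (μ / 4))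
    have := le_of_hasDerivAt_nonneg ht hd (fun s hs => by
      have e1 := hn s hs.1
      have e2 := tailMass_le_exp hμ s
      linarith)
    simp only [mul_zero, neg_zero, exp_zero] at this
    have e3 : 0 ≤ μ / 4 * exp (-(2 * t)) := by positivity
    linarith
  set c := μ / 4 * exp (2 * (g 0 - μ / 4)) with hc
  have hc0 : 0 < c := by positivity
  have h2 : ∀ t ≥ 0, G t + tailMass μ t + c * t ≤ G 0 + tailMass μ 0 := by
    intro t ht
    have hd : ∀ s ∈ Icc 0 t, HasDerivAt (fun s => -(G s + tailMass μ s + c * s))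
        (-(-(μ / 4 * sechSq s * exp (2 * g s)) + c * 1)) s := fun s _ =>
      ((h.hasDerivAt_add_tailMass s).add ((hasDerivAt_id s).const_mul c)).neg
    have := le_of_hasDerivAt_nonneg ht hd (fun s hs => by
      have e1 := exp_neg_le_sechSq hs.1
      have e2 : exp (2 * (s + (g 0 - μ / 4))) ≤ exp (2 * g s) :=
        exp_le_exp.2 (by linarith [h1 s hs.1])
      have e3 := mul_le_mul e1 e2 (exp_pos _).le (sechSq_pos s).le
      rw [← exp_add] at e3
      have e4 : -(2 * s) + 2 * (s + (g 0 - μ / 4)) = 2 * (g 0 - μ / 4) := by ring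
      rw [e4] at e3
      have e5 := mul_le_mul_of_nonneg_left e3 (by positivity : 0 ≤ μ / 4)
      rw [← hc] at e5
      linarith)
    simp only [mul_zero] at this
    linarith
  have h3 := h2 ((|G 0 + tailMass μ 0|) / c) (by positivity)
  have h4 := hn ((|G 0 + tailMass μ 0|) / c) (by positivity)
  rw [mul_div_cancel₀ _ hc0.ne'] at h3
  linarith [le_abs_self (G 0 + tailMass μ 0)]

/-- The constant in the decay bound of the potential. -/
def decayConst (μ c₀ c : ℝ) : ℝ :=
  2 * μ * exp (2 * c₀) * (1 + 8 / (2 * (1 - c)) ^ 2) ^ 2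

lemma isLinSol (h : IsLogSol μ a g G) (hμ : 0 < μ) (ha : a ≠ 0) {c₀ c : ℝ} (hc₀ : 0 ≤ c₀)
    (hc : 0 ≤ c) (hc1 : c < 1) (hg : ∀ t, g t ≤ c₀ + c * max t 0) :
    IsLinSol (potential μ g) g G a (decayConst μ c₀ c) where
  deriv_fst := h.deriv_fst
  deriv_snd t := (h.deriv_snd t).congr_deriv (by rw [potential_mul])
  cont := (continuous_const.mul continuous_sechSq).mul (continuous_expSlope.comp h.cont_fst)
  nonneg t := mul_nonneg (mul_nonneg (by positivity) (sechSq_pos t).le) (expSlope_pos _).le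
  bound t := by
    have hs := sechSq_pos t
    have h1 : expSlope (g t) ≤ 2 * exp (2 * (c₀ + c * max t 0)) :=
      expSlope_le (hg t) (by positivity)
    have hK : 1 ≤ (1 + 8 / (2 * (1 - c)) ^ 2) ^ 2 := by
      refine one_le_pow₀ ?_
      have : 0 ≤ 8 / (2 * (1 - c)) ^ 2 := by positivity
      linarith
    have hμs : 0 ≤ μ / 4 * sechSq t := by positivity
    have h2 := mul_le_mul_of_nonneg_left h1 hμs
    have hq : 0 < 1 + t ^ 2 := by positivity
    unfold potential decayConst
    rcases le_total t 0 with ht | ht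
    · rw [max_eq_right ht, mul_zero, add_zero] at h2
      have h3 := mul_le_mul_of_nonneg_right h2 hq.le
      refine h3.trans ?_
      have h4 := mul_le_mul_of_nonneg_left (sechSq_mul_le t)
        (by positivity : 0 ≤ μ / 2 * exp (2 * c₀))
      calc _ = μ / 2 * exp (2 * c₀) * (sechSq t * (1 + t ^ 2)) := by ring
        _ ≤ μ / 2 * exp (2 * c₀) * (4 / (1 + t ^ 2)) := h4
        _ = 2 * μ * exp (2 * c₀) * 1 / (1 + t ^ 2) := by ring
        _ ≤ _ := by gcongr
    · rw [max_eq_left ht] at h2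
      rw [le_div_iff₀ hq, mul_assoc, ← sq]
      have h3 := one_add_sq_sq_le_exp (by linarith : 0 < 2 * (1 - c)) ht
      have h4 := sechSq_le_exp_neg t
      calc μ / 4 * sechSq t * expSlope (g t) * (1 + t ^ 2) ^ 2
          ≤ μ / 4 * sechSq t * (2 * exp (2 * (c₀ + c * t))) * (1 + t ^ 2) ^ 2 := by gcongr
        _ ≤ μ / 4 * (4 * exp (-(2 * t))) * (2 * exp (2 * (c₀ + c * t))) *
            ((1 + 8 / (2 * (1 - c)) ^ 2) ^ 2 * exp (2 * (1 - c) * t)) := by gcongr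
        _ = 2 * μ * (1 + 8 / (2 * (1 - c)) ^ 2) ^ 2 *
            (exp (-(2 * t)) * exp (2 * (c₀ + c * t)) * exp (2 * (1 - c) * t)) := by ring
        _ = _ := by
          rw [← exp_add, ← exp_add]
          have : -(2 * t) + 2 * (c₀ + c * t) + 2 * (1 - c) * t = 2 * c₀ := by ring
          rw [this]; ring
  lim_fst := h.lim_intercept
  lim_snd := h.lim_snd
  ne_zero := ha

lemma fst_le_of_add_tailMass_le (h : IsLogSol μ a g G) (hμ : 0 < μ) {B T c : ℝ} (ha : a ≤ B)
    (hT : 0 ≤ T) (hc : 0 ≤ c) (hTc : G T + tailMass μ T ≤ c) (t : ℝ) :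
    g t ≤ (B + μ / 4 * log (1 + exp (2 * T))) + c * max t 0 := by
  have hle : ∀ t ≤ T, g t ≤ B + μ / 4 * log (1 + exp (2 * T)) := fun t ht => by
    have h1 : log (1 + exp (2 * t)) ≤ log (1 + exp (2 * T)) :=
      log_le_log (by positivity) (by linarith [exp_le_exp.2 (by linarith : 2 * t ≤ 2 * T)])
    have h2 := h.fst_le hμ t
    have h3 := mul_le_mul_of_nonneg_left h1 (by positivity : 0 ≤ μ / 4)
    linarith
  rcases le_total t T with ht | ht
  · have := hle t ht
    have : 0 ≤ c * max t 0 := by positivity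
    linarith
  · have h1 := le_of_hasDerivAt_nonneg ht
      (fun s _ => ((hasDerivAt_id s).const_mul c).sub (h.deriv_fst s)) (fun s hs => by
        have e1 := h.antitone_add_tailMass hμ hs.1
        have e2 := (tailMass_pos hμ s).le
        simp only at e1
        linarith)
    have h2 := hle T le_rfl
    simp only [id, Pi.sub_apply] at h1
    have h3 : c * t ≤ c * max t 0 := mul_le_mul_of_nonneg_left (le_max_left _ _) hc
    have h4 : 0 ≤ c * T := by positivity
    linarith

lemma exists_isLinSol (h : IsLogSol μ a g G) (hμ : 0 < μ) (ha : a ≠ 0) :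
    ∃ C, IsLinSol (potential μ g) g G a C := by
  obtain ⟨T, hT0, hT⟩ := h.exists_add_tailMass_lt_one hμ
  have hl : 0 ≤ log (1 + exp (2 * T)) := log_nonneg (by linarith [exp_pos (2 * T)])
  exact ⟨_, h.isLinSol hμ ha (c₀ := max a 0 + μ / 4 * log (1 + exp (2 * T)))
    (c := max (G T + tailMass μ T) 0) (by positivity) (le_max_right _ _)
    (max_lt hT one_pos) (h.fst_le_of_add_tailMass_le hμ (le_max_left _ _) hT0
      (le_max_right _ _) (le_max_left _ _))⟩

end IsLogSol

/-! ### The total angle as a function of the central value -/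

namespace IsLinSol

variable {Q y G : ℝ → ℝ} {a C : ℝ}

lemma phaseNormSq_le (h : IsLinSol Q y G a C) (t : ℝ) :
    phaseNormSq y G t ≤ a ^ 2 * exp (2 * (C * π)) := by
  have hd : ∀ s ≤ t, HasDerivAt (fun s => -(phaseNormSq y G s * exp (-(2 * arctanPrim C s))))
      (-(2 * (Q s * y s) * (s * (y s - s * G s) - G s) * exp (-(2 * arctanPrim C s))
        + phaseNormSq y G s * (exp (-(2 * arctanPrim C s)) * (-(2 * (C / (1 + s ^ 2))))))) s :=
    fun s _ => ((h.hasDerivAt_phaseNormSq s).mul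
      (((hasDerivAt_arctanPrim C s).const_mul 2).neg.exp)).neg
  have hlim : Tendsto (fun s => -(phaseNormSq y G s * exp (-(2 * arctanPrim C s)))) atBot
      (𝓝 (-(a ^ 2))) := by
    have h1 := (((h.lim_fst.pow 2).add (h.lim_snd.pow 2)).mul
      ((continuous_exp.tendsto _).comp ((tendsto_arctanPrim C).const_mul 2).neg)).neg
    simpa [phaseNormSq, Function.comp_def] using h1
  have key := le_of_tendsto_atBot_of_hasDerivAt_nonneg hlim hd (fun s _ => by
    have h1 : 2 * (y s * (s * (y s - s * G s) - G s))
        ≤ (1 + s ^ 2) * phaseNormSq y G s * 2 := by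
      unfold phaseNormSq
      nlinarith [sq_nonneg (y s + (s * (y s - s * G s) - G s)),
        sq_nonneg (y s - (s * (y s - s * G s) - G s)), sq_nonneg (y s - s * G s), sq_nonneg (G s),
        mul_nonneg (sq_nonneg s) (sq_nonneg (y s - s * G s)),
        mul_nonneg (sq_nonneg s) (sq_nonneg (G s))]
    have h3 : 0 ≤ phaseNormSq y G s := by unfold phaseNormSq; positivity
    have h4 := mul_le_mul_of_nonneg_right (h.bound s) h3
    have h5 := mul_le_mul_of_nonneg_left h1 (h.nonneg s)
    have h6 : 0 ≤ -(2 * (Q s * y s) * (s * (y s - s * G s) - G s))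
        + phaseNormSq y G s * (2 * (C / (1 + s ^ 2))) := by nlinarith
    have := mul_nonneg h6 (exp_pos (-(2 * arctanPrim C s))).le
    linarith)
  have h4 : exp (2 * arctanPrim C t) ≤ exp (2 * (C * π)) :=
    exp_le_exp.2 (by linarith [arctanPrim_le h.const_nonneg t])
  have h5 := mul_le_mul_of_nonneg_right (neg_le_neg_iff.1 key) (exp_pos (2 * arctanPrim C t)).le
  rw [mul_assoc, ← exp_add, neg_add_cancel, exp_zero, mul_one] at h5
  exact h5.trans (mul_le_mul_of_nonneg_left h4 (sq_nonneg a))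

lemma tendsto_snd_of_totalPhase_eq (h : IsLinSol Q y G a C) {j : ℕ}
    (hj : totalPhase Q y G = j * π) : Tendsto G atTop (𝓝 0) := by
  have h1 : Tendsto (fun t => a ^ 2 * exp (2 * (C * π)) * sin (phase Q y G t) ^ 2) atTop (𝓝 0) := by
    have h2 := (continuous_sin.tendsto _).comp h.tendsto_phase_atTop
    rw [hj, sin_nat_mul_pi] at h2
    simpa [Function.comp_def] using (h2.pow 2).const_mul (a ^ 2 * exp (2 * (C * π)))
  have h2 : Tendsto (fun t => G t ^ 2) atTop (𝓝 0) := by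
    refine squeeze_zero (fun t => sq_nonneg _) (fun t => ?_) h1
    have hp := h.parallel t
    have hs := sin_sq_add_cos_sq (phase Q y G t)
    have h3 : G t ^ 2 = phaseNormSq y G t * sin (phase Q y G t) ^ 2 := by
      unfold phaseNormSq
      linear_combination (- G t ^ 2) * hs + (-(y t - t * G t) * sin (phase Q y G t)
        + G t * cos (phase Q y G t)) * hp
    rw [h3]
    exact mul_le_mul_of_nonneg_right (h.phaseNormSq_le t) (sq_nonneg _)
  have h3 := h2.sqrt
  rw [sqrt_zero] at h3
  refine (tendsto_zero_iff_abs_tendsto_zero _).2 ?_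
  exact h3.congr fun t => sqrt_sq_eq_abs _

end IsLinSol

lemma continuousOn_of_abs_sub_le {s : Set ℝ} {u : ℝ → ℝ} {C : ℝ} (hC : 0 ≤ C)
    (h : ∀ a ∈ s, ∀ b ∈ s, |u a - u b| ≤ C * |a - b|) : ContinuousOn u s :=
  (LipschitzOnWith.of_dist_le_mul (K := ⟨C, hC⟩) fun a ha b hb => h a ha b hb).continuousOn

/-- A family of solutions indexed by the central value, locally Lipschitz in it. -/
structure IsLogFamily (μ B : ℝ) (g G : ℝ → ℝ → ℝ) : Prop where
  sol : ∀ a ≤ B, IsLogSol μ a (g a) (G a)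
  lip : ∀ T, ∃ C ≥ 0, ∀ a ≤ B, ∀ b ≤ B, ∀ t ≤ T,
    |g a t - g b t| ≤ C * |a - b| ∧ |G a t - G b t| ≤ C * |a - b|
  zero : ∀ t, g 0 t = 0

/-- The total angle of the solution with central value `a`. -/
def familyPhase (μ : ℝ) (g G : ℝ → ℝ → ℝ) (a : ℝ) : ℝ :=
  totalPhase (potential μ (g a)) (g a) (G a)

namespace IsLogFamily

variable {μ B : ℝ} {g G : ℝ → ℝ → ℝ}

lemma continuousOn_fst (h : IsLogFamily μ B g G) (t : ℝ) :
    ContinuousOn (fun a => g a t) (Iic B) := by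
  obtain ⟨C, hC, H⟩ := h.lip t
  exact continuousOn_of_abs_sub_le hC fun a ha b hb => (H a ha b hb t le_rfl).1

lemma continuousOn_snd (h : IsLogFamily μ B g G) (t : ℝ) :
    ContinuousOn (fun a => G a t) (Iic B) := by
  obtain ⟨C, hC, H⟩ := h.lip t
  exact continuousOn_of_abs_sub_le hC fun a ha b hb => (H a ha b hb t le_rfl).2

lemma continuousOn_familyPhase (h : IsLogFamily μ B g G) (hμ : 0 < μ) :
    ContinuousOn (familyPhase μ g G) (Iic B \ {0}) := by
  intro a₀ ha₀
  obtain ⟨T, hT0, hT⟩ := (h.sol a₀ ha₀.1).exists_add_tailMass_lt_one hμ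
  obtain ⟨c, hc1, hc2⟩ := exists_between (max_lt hT one_pos)
  have hc0 : 0 ≤ c := (le_max_right _ _).trans hc1.le
  have hev : ∀ᶠ a in 𝓝[Iic B \ {0}] a₀, a ∈ Iic B \ {0} ∧ G a T + tailMass μ T < c :=
    eventually_mem_nhdsWithin.and
      ((((h.continuousOn_snd T).mono sdiff_subset).add
        continuousOn_const a₀ ha₀).eventually_lt_const ((le_max_left _ _).trans_lt hc1))
  have hl : 0 ≤ log (1 + exp (2 * T)) := log_nonneg (by linarith [exp_pos (2 * T)])
  obtain ⟨C, hlin⟩ : ∃ C, ∀ a, (a ∈ Iic B \ {0} ∧ G a T + tailMass μ T < c) →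
      IsLinSol (potential μ (g a)) (g a) (G a) a C := ⟨
        IsLogSol.decayConst μ (max B 0 + μ / 4 * log (1 + exp (2 * T))) c, fun a ha =>
    (h.sol a ha.1.1).isLinSol hμ ha.1.2 (by positivity) hc0 hc2
      ((h.sol a ha.1.1).fst_le_of_add_tailMass_le hμ (le_trans ha.1.1 (le_max_left _ _)) hT0 hc0
        ha.2.le)⟩
  refine continuousWithinAt_of_dominated
    (hev.mono fun a ha => (hlin a ha).continuous_phaseSpeed.aestronglyMeasurable)
    (hev.mono fun a ha => Eventually.of_forall fun t => ?_) (IsLinSol.integrable_bound C)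
    (Eventually.of_forall fun t => ?_)
  · rw [norm_of_nonneg ((hlin a ha).phaseSpeed_nonneg t)]
    exact (hlin a ha).phaseSpeed_le t
  · have h1 := (h.continuousOn_fst t).mono sdiff_subset a₀ ha₀
    have h2 := (h.continuousOn_snd t).mono sdiff_subset a₀ ha₀
    have hC := hlin a₀ (hev.self_of_nhdsWithin ha₀)
    have h3 : ContinuousWithinAt (fun a => potential μ (g a) t) (Iic B \ {0}) a₀ :=
      continuousWithinAt_const.mul (continuous_expSlope.continuousAt.comp_continuousWithinAt h1)
    exact (h3.mul (h1.pow 2)).div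
      (((h1.sub (continuousWithinAt_const.mul h2)).pow 2).add (h2.pow 2))
      (hC.phaseNormSq_pos t).ne'

/-- Near the zero solution the angle is at least that of the linearised equation. -/
lemma exists_le_familyPhase (h : IsLogFamily μ B g G) (hB : 0 ≤ B) (k : ℕ)
    (hμ : 2 * (k : ℝ) * (k + 1) < μ) :
    ∃ ε > 0, ∀ a ≤ B, a ≠ 0 → |a| < ε → k * π ≤ familyPhase μ g G a := by
  have hμ0 : 0 < μ := lt_of_le_of_lt (by positivity) hμ
  obtain ⟨κ, hκ1, hκ2⟩ := exists_between (show (k : ℝ) * (k + 1) < μ / 2 by linarith)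
  obtain ⟨T, hT⟩ := exists_mul_pi_le_phase k (μ / 4 * 3) hκ1
  have hκ3 : κ / (μ / 4) < 2 := by rw [div_lt_iff₀ (by positivity)]; linarith
  have hn : {x | κ / (μ / 4) < expSlope x ∧ expSlope x < 3} ∈ 𝓝 (0 : ℝ) :=
    (continuous_expSlope.continuousAt.eventually_const_lt (by rwa [expSlope_zero])).and
      (continuous_expSlope.continuousAt.eventually_lt_const (by rw [expSlope_zero]; norm_num))
  obtain ⟨δ, hδ, hball⟩ := Metric.mem_nhds_iff.1 hn
  obtain ⟨C, hC, hlip⟩ := h.lip T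
  refine ⟨δ / (C + 1), by positivity, fun a haB ha0 haε => ?_⟩
  have hslope : ∀ t ≤ T, κ / (μ / 4) < expSlope (g a t) ∧ expSlope (g a t) < 3 := by
    intro t ht
    refine hball ?_
    have h1 := (hlip a haB 0 hB t ht).1
    rw [h.zero, sub_zero, sub_zero] at h1
    rw [lt_div_iff₀ (by positivity)] at haε
    rw [mem_ball_zero_iff, norm_eq_abs]
    nlinarith [abs_nonneg a]
  obtain ⟨C', hL⟩ := (h.sol a haB).exists_isLinSol hμ0 ha0
  refine (hT _ _ (fun t _ => hL.hasDerivAt_phase' t) (fun t ht => ?_) (fun t ht => ?_)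
    hL.tendsto_phase_atBot).trans (hL.phase_le_total T)
  · have h1 := mul_le_mul_of_nonneg_left (hslope t ht).1.le
      (mul_pos (by positivity : 0 < μ / 4) (sechSq_pos t)).le
    unfold potential
    refine le_trans (le_of_eq ?_) h1
    field_simp
  · have h1 := mul_le_mul_of_nonneg_left (hslope t ht).2.le
      (mul_pos (by positivity : 0 < μ / 4) (sechSq_pos t)).le
    unfold potential
    linarith

end IsLogFamily

/-! ### Few critical points for large central values -/

namespace IsLinSol

variable {Q y G : ℝ → ℝ} {a C : ℝ}

lemma exists_zero_of_phase (h : IsLinSol Q y G a C) {j : ℕ} (hj : 0 < j)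
    (hlt : j * π < totalPhase Q y G) : ∃ t, phase Q y G t = j * π ∧ G t = 0 := by
  have hpos : (0 : ℝ) < j * π := mul_pos (by exact_mod_cast hj) pi_pos
  obtain ⟨t₁, h₁⟩ := (h.tendsto_phase_atBot.eventually_lt_const hpos).exists
  obtain ⟨t₂, h₂⟩ := (h.tendsto_phase_atTop.eventually_const_lt hlt).exists
  obtain ⟨t, ht⟩ := mem_range_of_exists_le_of_exists_ge h.continuous_phase ⟨t₁, h₁.le⟩ ⟨t₂, h₂.le⟩
  exact ⟨t, ht, (h.sin_phase_eq_zero_iff t).1 (by rw [ht, sin_nat_mul_pi])⟩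

lemma totalPhase_le_of_forall_eq (h : IsLinSol Q y G a C) {T₁ : ℝ} (hT : ∀ t, G t = 0 → t = T₁) :
    totalPhase Q y G ≤ 2 * π := by
  by_contra! hn
  obtain ⟨t₁, h₁, h₁'⟩ := h.exists_zero_of_phase (j := 1) one_pos (by push_cast; linarith [pi_pos])
  obtain ⟨t₂, h₂, h₂'⟩ := h.exists_zero_of_phase (j := 2) two_pos (by push_cast; linarith)
  rw [hT t₁ h₁'] at h₁
  rw [hT t₂ h₂', h₁] at h₂
  push_cast at h₂
  linarith [pi_pos]

lemma totalPhase_le_of_forall_eq_or (h : IsLinSol Q y G a C) {T₁ T₂ : ℝ}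
    (hT : ∀ t, G t = 0 → t = T₁ ∨ t = T₂) : totalPhase Q y G ≤ 3 * π := by
  by_contra! hn
  have hπ := pi_pos
  obtain ⟨t₁, h₁, h₁'⟩ := h.exists_zero_of_phase (j := 1) one_pos (by push_cast; linarith)
  obtain ⟨t₂, h₂, h₂'⟩ := h.exists_zero_of_phase (j := 2) two_pos (by push_cast; linarith)
  obtain ⟨t₃, h₃, h₃'⟩ := h.exists_zero_of_phase (j := 3) three_pos (by push_cast; linarith)
  push_cast at h₁ h₂ h₃
  rcases hT t₁ h₁' with rfl | rfl <;> rcases hT t₂ h₂' with rfl | rfl <;>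
    rcases hT t₃ h₃' with rfl | rfl <;> linarith

end IsLinSol

namespace IsLogSol

variable {μ a : ℝ} {g G : ℝ → ℝ}

lemma snd_le_snd (h : IsLogSol μ a g G) (hμ : 0 < μ) {s t : ℝ} (hst : s ≤ t)
    (hg : ∀ r ∈ Icc s t, 0 ≤ g r) : G t ≤ G s :=
  neg_le_neg_iff.1 (le_of_hasDerivAt_nonneg (u := -G) hst (fun r _ => (h.deriv_snd r).neg)
    fun r hr => by
    have h1 := one_le_exp (by linarith [hg r hr] : 0 ≤ 2 * g r)
    have h2 := sechSq_pos r
    rw [neg_neg]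
    exact mul_nonneg (by positivity) (by linarith))

lemma snd_lt_snd (h : IsLogSol μ a g G) (hμ : 0 < μ) {s t : ℝ} (hst : s < t)
    (hg : ∀ r ∈ Ioo s t, 0 < g r) : G t < G s :=
  neg_lt_neg_iff.1 (lt_of_hasDerivAt_pos (u := -G) hst (fun r _ => (h.deriv_snd r).neg)
    fun r hr => by
    have h1 := one_lt_exp_iff.2 (by linarith [hg r hr] : 0 < 2 * g r)
    have h2 := sechSq_pos r
    rw [neg_neg]
    exact mul_pos (by positivity) (by linarith))

lemma snd_lt_snd_of_neg (h : IsLogSol μ a g G) (hμ : 0 < μ) {s t : ℝ} (hst : s < t)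
    (hg : ∀ r ∈ Ioo s t, g r < 0) : G s < G t :=
  lt_of_hasDerivAt_pos hst (fun r _ => h.deriv_snd r) fun r hr => by
    have h1 := exp_lt_one_iff.2 (by linarith [hg r hr] : 2 * g r < 0)
    have h2 := sechSq_pos r
    rw [← mul_neg]
    exact mul_pos (by positivity) (by linarith)

/-- Comparison of increments of `g` with a lower bound for the slope. -/
lemma le_fst_sub (h : IsLogSol μ a g G) {s t c : ℝ} (hst : s ≤ t) (hc : ∀ r ∈ Icc s t, c ≤ G r) :
    c * (t - s) ≤ g t - g s := by
  have := le_of_hasDerivAt_nonneg hst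
    (fun r _ => (h.deriv_fst r).sub ((hasDerivAt_id r).const_mul c)) fun r hr => by
      linarith [hc r hr]
  simp only [Pi.sub_apply, id] at this
  linarith

/-- Comparison of increments of `g` with an upper bound for the slope. -/
lemma fst_sub_le (h : IsLogSol μ a g G) {s t c : ℝ} (hst : s ≤ t) (hc : ∀ r ∈ Icc s t, G r ≤ c) :
    g t - g s ≤ c * (t - s) := by
  have := le_of_hasDerivAt_nonneg hst
    (fun r _ => ((hasDerivAt_id r).const_mul c).sub (h.deriv_fst r)) fun r hr => by
      linarith [hc r hr]
  simp only [Pi.sub_apply, id] at this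
  linarith

/-- After a high critical point `g` is decreasing. -/
lemma snd_neg_of_lt (h : IsLogSol μ a g G) (hμ : 0 < μ) {t₁ t : ℝ} (ht₁ : 0 ≤ t₁)
    (hG : G t₁ = 0) (hg : μ / 2 < g t₁) (ht : t₁ < t) : G t < 0 := by
  by_cases hz : ∃ s ∈ Icc t₁ t, g s ≤ 0
  swap
  · push Not at hz
    rw [← hG]
    exact h.snd_lt_snd hμ ht fun r hr => hz r (Ioo_subset_Icc_self hr)
  obtain ⟨s, hs, hs0⟩ := hz
  obtain ⟨t₂, ht₂, h₂, hpos⟩ := exists_first_zero h.cont_fst hs.1 (by linarith) hs0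
  have hdec : ∀ r ∈ Icc t₁ t₂, G t₂ ≤ G r := fun r hr => h.snd_le_snd hμ hr.2 fun q hq => by
    rcases hq.2.eq_or_lt with rfl | hlt
    · exact h₂.ge
    · exact (hpos q ⟨hr.1.trans hq.1, hlt⟩).le
  have hW : G t₂ + tailMass μ t₂ ≤ 0 := by
    by_contra! hn
    have h1 := h.le_fst_sub ht₂.1.le hdec
    have h2 := tailMass_le_exp hμ t₂
    have h3 : t₂ * exp (-(2 * t₂)) ≤ 1 := by
      rw [exp_neg, ← div_eq_mul_inv, div_le_one (exp_pos _)]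
      linarith [add_one_le_exp (2 * t₂), ht₂.1]
    have h4 := tailMass_pos hμ t₂
    have h5 : tailMass μ t₂ * (t₂ - t₁) ≤ μ / 2 * exp (-(2 * t₂)) * t₂ :=
      mul_le_mul h2 (by linarith) (by linarith [ht₂.1]) (by positivity)
    have h6 : -G t₂ * (t₂ - t₁) ≤ tailMass μ t₂ * (t₂ - t₁) :=
      mul_le_mul_of_nonneg_right (by linarith) (by linarith [ht₂.1])
    have h7 := mul_le_mul_of_nonneg_left h3 (by positivity : 0 ≤ μ / 2)
    linarith
  have h1 := h.antitone_add_tailMass hμ (ht₂.2.trans hs.2)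
  have h2 := tailMass_pos hμ t
  simp only at h1
  linarith

/-- If the slope is large compared with the remaining mass, there is at most one critical point
left. -/
lemma exists_forall_eq_of_zero (h : IsLogSol μ a g G) (hμ : 0 < μ) {t₀ : ℝ} (ht₀ : 0 ≤ t₀)
    (hG : exp μ * tailMass μ t₀ < G t₀) : ∃ T, ∀ t ≥ t₀, G t = 0 → t = T := by
  by_cases hz : ∃ s ≥ t₀, G s = 0
  swap
  · exact ⟨0, fun t ht h0 => (hz ⟨t, ht, h0⟩).elim⟩
  obtain ⟨s, hs, hs0⟩ := hz
  have hpos₀ : 0 < G t₀ := lt_of_le_of_lt (mul_nonneg (exp_pos _).le (tailMass_pos hμ _).le) hG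
  obtain ⟨t₁, ht₁, h₁, hpos⟩ := exists_first_zero h.cont_snd hs hpos₀ hs0.le
  have hnn : ∀ r ∈ Icc t₀ t₁, 0 ≤ G r := fun r hr => by
    rcases hr.2.eq_or_lt with rfl | hlt
    · exact h₁.ge
    · exact (hpos r ⟨hr.1, hlt⟩).le
  have hg : μ / 2 < g t₁ := by
    by_contra! hn
    have hle : ∀ r ∈ Icc t₀ t₁, g r ≤ μ / 2 := fun r hr => by
      have := h.le_fst_sub hr.2 fun q hq => hnn q ⟨hr.1.trans hq.1, hq.2⟩
      linarith
    have := le_of_hasDerivAt_nonneg ht₁.1.le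
      (fun r _ => (h.deriv_snd r).sub ((hasDerivAt_tailMass μ r).const_mul (exp μ)))
      (fun r hr => by
        have h1 : exp (2 * g r) ≤ exp μ := exp_le_exp.2 (by linarith [hle r hr])
        have h2 : 0 ≤ μ / 4 * sechSq r := mul_nonneg (by positivity) (sechSq_pos r).le
        nlinarith)
    have h2 := mul_pos (exp_pos μ) (tailMass_pos hμ t₁)
    simp only [Pi.sub_apply] at this
    linarith
  refine ⟨t₁, fun t ht h0 => ?_⟩
  rcases lt_trichotomy t t₁ with hlt | heq | hlt
  · exact absurd h0 (hpos t ⟨ht, hlt⟩).ne'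
  · exact heq
  · exact absurd h0 (h.snd_neg_of_lt hμ (ht₀.trans ht₁.1.le) h₁ hg hlt).ne

end IsLogSol

lemma exists_exp_mul_tailMass_lt (μ : ℝ) {ε : ℝ} (hε : 0 < ε) (T : ℝ) :
    ∃ t ≥ T, exp μ * tailMass μ t < ε := by
  have h := (tendsto_tailMass_atTop μ).const_mul (exp μ)
  rw [mul_zero] at h
  obtain ⟨t, h1, h2⟩ := ((h.eventually_lt_const hε).and (eventually_ge_atTop T)).exists
  exact ⟨t, h2, h1⟩

/-- For very negative central values the angle is at most `2π`. -/
lemma exists_totalPhase_le_two_mul_pi {μ : ℝ} (hμ : 0 < μ) :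
    ∃ A > 0, ∀ g G, IsLogSol μ (-A) g G → totalPhase (potential μ g) g G ≤ 2 * π := by
  obtain ⟨t₀, ht₀, hsmall⟩ := exists_exp_mul_tailMass_lt μ (by positivity : 0 < μ / 8) 0
  have hl : 0 ≤ log (1 + exp (2 * t₀)) := log_nonneg (by linarith [exp_pos (2 * t₀)])
  have hA : 0 < 1 + μ / 4 * log (1 + exp (2 * t₀)) := by positivity
  refine ⟨_, hA, fun g G h => ?_⟩
  have hg : ∀ t ≤ t₀, g t ≤ -1 := fun t ht => by
    have h1 : log (1 + exp (2 * t)) ≤ log (1 + exp (2 * t₀)) :=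
      log_le_log (by positivity) (by linarith [exp_le_exp.2 (by linarith : 2 * t ≤ 2 * t₀)])
    have h2 := h.fst_le hμ t
    have h3 := mul_le_mul_of_nonneg_left h1 (by positivity : 0 ≤ μ / 4)
    linarith
  have hG : ∀ t ≤ t₀, μ / 4 - tailMass μ t / 2 ≤ G t := fun t ht => by
    have hlim := h.lim_snd.add ((tendsto_tailMass_atBot μ).div_const 2)
    have := le_of_tendsto_atBot_of_hasDerivAt_nonneg hlim (b := t)
      (fun s _ => (h.deriv_snd s).add ((hasDerivAt_tailMass μ s).div_const 2)) (fun s hs => by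
        have h1 : exp (2 * g s) ≤ exp (-1) := exp_le_exp.2 (by linarith [hg s (hs.trans ht)])
        have h2 : exp (-1) ≤ 1 / 2 := by
          rw [exp_neg, inv_le_comm₀ (exp_pos _) (by norm_num)]
          linarith [add_one_le_exp (1 : ℝ)]
        have h3 : 0 ≤ μ / 4 * sechSq s := mul_nonneg (by positivity) (sechSq_pos s).le
        nlinarith)
    linarith
  obtain ⟨T, hT⟩ := h.exists_forall_eq_of_zero hμ ht₀ (by
    have h1 := hG t₀ le_rfl
    have h2 : tailMass μ t₀ ≤ μ / 4 := by
      rw [tailMass_eq, div_le_iff₀ (by positivity)]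
      nlinarith [one_le_exp (by linarith : 0 ≤ 2 * t₀)]
    linarith)
  obtain ⟨C, hL⟩ := h.exists_isLinSol hμ (by linarith : -(1 + μ / 4 * log (1 + exp (2 * t₀))) ≠ 0)
  refine hL.totalPhase_le_of_forall_eq (T₁ := T) fun t h0 => ?_
  rcases le_total t₀ t with ht | ht
  · exact hT t ht h0
  · have h1 := hG t ht
    have h2 : tailMass μ t < μ / 2 := by
      rw [tailMass_eq, div_lt_iff₀ (by positivity)]
      nlinarith [exp_pos (2 * t)]
    linarith

lemma tendsto_sechSq_atBot : Tendsto sechSq atBot (𝓝 0) := by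
  have h := (tendsto_expTanh_atBot.pow 2).const_sub 1
  norm_num at h
  exact h.congr fun t => by rw [expTanh_sq]; ring

namespace IsLogSol

variable {μ a : ℝ} {g G : ℝ → ℝ}

lemma le_fst_of_nonpos (h : IsLogSol μ a g G) (hμ : 0 < μ) {t : ℝ} (ht : t ≤ 0) :
    a - μ / 4 * (exp (μ / 2) * exp (2 * (t + a))) ≤ g t := by
  set c := exp (μ / 2 + 2 * a) with hc
  have hc0 : 0 < c := exp_pos _
  have hG : ∀ s ≤ 0, 0 ≤ G s + μ / 2 * c * exp (2 * s) := fun s hs => by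
    have hlim : Tendsto (fun s => G s + μ / 2 * c * exp (2 * s)) atBot (𝓝 0) := by
      simpa using h.lim_snd.add (tendsto_exp_two_mul_atBot.const_mul (μ / 2 * c))
    refine le_of_tendsto_atBot_of_hasDerivAt_nonneg
      (u := fun s => G s + μ / 2 * c * exp (2 * s)) hlim (fun r _ =>
      (h.deriv_snd r).add ((hasDerivAt_exp_two_mul r).const_mul (μ / 2 * c))) fun r hr => ?_
    have h1 : log (1 + exp (2 * r)) ≤ 1 := by
      have := log_le_sub_one_of_pos (by positivity : 0 < 1 + exp (2 * r))
      have := exp_le_one_iff.2 (by linarith : 2 * r ≤ 0)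
      linarith
    have h2 : exp (2 * g r) ≤ c := exp_le_exp.2 (by
      have := h.fst_le hμ r
      nlinarith)
    have h3 := mul_le_mul (sechSq_le_exp r) h2 (exp_pos _).le (by positivity)
    have h4 := mul_pos hμ (sechSq_pos r)
    have h5 := mul_le_mul_of_nonneg_left h3 (by positivity : 0 ≤ μ / 4)
    linarith
  have hlim : Tendsto (fun s => g s + μ / 4 * c * exp (2 * s)) atBot (𝓝 a) := by
    simpa using h.lim_fst.add (tendsto_exp_two_mul_atBot.const_mul (μ / 4 * c))
  have h1 := le_of_tendsto_atBot_of_hasDerivAt_nonneg hlim (b := t) (fun r _ =>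
      (h.deriv_fst r).add ((hasDerivAt_exp_two_mul r).const_mul (μ / 4 * c))) fun r hr => by
    linarith [hG r (hr.trans ht)]
  have h2 : exp (μ / 2) * exp (2 * (t + a)) = c * exp (2 * t) := by
    rw [hc, ← exp_add, ← exp_add]; ring_nf
  rw [h2]
  linarith

lemma snd_nonpos (h : IsLogSol μ a g G) (hμ : 0 < μ) {T : ℝ} (hg : ∀ t ≤ T, 0 ≤ g t) {t : ℝ}
    (ht : t ≤ T) : G t ≤ 0 :=
  le_of_tendsto_of_tendsto tendsto_const_nhds h.lim_snd (by
    filter_upwards [eventually_le_atBot t] with s hs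
    exact h.snd_le_snd hμ hs fun r hr => hg r (hr.2.trans ht))

lemma fst_le_of_nonneg (h : IsLogSol μ a g G) (hμ : 0 < μ) {T : ℝ} (hg : ∀ t ≤ T, 0 ≤ g t) :
    g T ≤ a :=
  le_of_tendsto_of_tendsto tendsto_const_nhds h.lim_fst (by
    filter_upwards [eventually_le_atBot T] with s hs
    have := h.fst_sub_le hs (c := 0) fun r hr => h.snd_nonpos hμ hg hr.2
    linarith)

lemma snd_neg (h : IsLogSol μ a g G) (hμ : 0 < μ) {T : ℝ} (hg : ∀ t < T, 0 < g t) {t : ℝ}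
    (ht : t ≤ T) : G t < 0 := by
  have hT : ∀ s ≤ t - 1, 0 ≤ g s := fun s hs => (hg s (by linarith)).le
  exact (h.snd_lt_snd hμ (by linarith : t - 1 < t) fun r hr => hg r (hr.2.trans_le ht)).trans_le
    (h.snd_nonpos hμ hT le_rfl)

/-- An energy estimate on the initial interval of positivity. -/
lemma energy_le (h : IsLogSol μ a g G) (hμ : 0 < μ) {T : ℝ} (hg : ∀ t ≤ T, 0 ≤ g t) :
    G T ^ 2 / 2 + G T + tailMass μ T ≤ μ / 2 := by
  have hlim : Tendsto (fun t => -(G t ^ 2 / 2 + G t + μ / 8 * sechSq t * exp (2 * g t)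
      + tailMass μ t)) atBot (𝓝 (-(μ / 2))) := by
    have h1 := ((((h.lim_snd.pow 2).div_const 2).add h.lim_snd).add
      ((tendsto_sechSq_atBot.const_mul (μ / 8)).mul (h.lim_fst.const_mul 2).rexp)).add
      (tendsto_tailMass_atBot μ)
    simpa using h1.neg
  have hd : ∀ t ≤ T, HasDerivAt (fun t => -(G t ^ 2 / 2 + G t + μ / 8 * sechSq t * exp (2 * g t)
      + tailMass μ t)) (μ / 4 * sechSq t * exp (2 * g t) * (1 + expTanh t)
        - μ / 4 * sechSq t * G t) t := fun t _ => by
    have h1 := (((((h.deriv_snd t).pow 2).div_const 2).add (h.deriv_snd t)).add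
      (((hasDerivAt_sechSq t).const_mul (μ / 8)).mul ((h.deriv_fst t).const_mul 2).exp)).add
      (hasDerivAt_tailMass μ t)
    exact h1.neg.congr_deriv (by push_cast; ring)
  have h1 := le_of_tendsto_atBot_of_hasDerivAt_nonneg hlim hd fun t ht => by
    have h1 := h.snd_nonpos hμ hg ht
    have h2 := (abs_le.1 (abs_expTanh_le t)).1
    have h3 : 0 ≤ μ / 4 * sechSq t := mul_nonneg (by positivity) (sechSq_pos t).le
    have h4 := mul_nonneg (mul_nonneg h3 (exp_pos (2 * g t)).le) (by linarith : 0 ≤ 1 + expTanh t)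
    nlinarith
  have h2 : 0 ≤ μ / 8 * sechSq T * exp (2 * g T) :=
    mul_nonneg (mul_nonneg (by positivity) (sechSq_pos T).le) (exp_pos _).le
  linarith

end IsLogSol

/-- For large central values the slope soon drops below `-1`, by a definite amount. -/
lemma exists_eventually_snd_le {μ : ℝ} (hμ : 0 < μ) :
    ∃ L ≥ 1, ∀ᶠ a in atTop, ∀ g G, IsLogSol μ a g G →
      ∃ t ∈ Icc (-a) (-a + L), G t ≤ -1 - 1 / L ∧ ∀ s ≤ t, 0 < g s := by
  set K := μ / 4 * exp (μ / 2) with hK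
  have hK0 : 0 < K := by positivity
  set c := μ / 4 * exp (-2 * K - 2) with hc
  have hc0 : 0 < c := by positivity
  set L := 1 + 4 / c with hL
  have hL1 : 1 ≤ L := by
    have : 0 < 4 / c := by positivity
    linarith
  have hL0 : 0 < L := by linarith
  have hδ1 : 1 / L ≤ 1 := by rw [div_le_one hL0]; exact hL1
  have hδ0 : 0 < 1 / L := by positivity
  refine ⟨L, hL1, ?_⟩
  have hsmall : ∀ᶠ a in atTop, μ * exp (2 * (L + -a)) < c / 2 := by
    have h1 := (tendsto_exp_two_mul_atBot.comp (tendsto_atBot_add_const_left atTop L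
      tendsto_neg_atTop_atBot)).const_mul μ
    rw [mul_zero] at h1
    exact h1.eventually_lt_const (by positivity)
  filter_upwards [hsmall, eventually_gt_atTop (K + 2 * L)] with a ha₁ ha₂ g G h
  have hearly : ∀ s ≤ -a, a - K ≤ g s := fun s hs => by
    have h1 := h.le_fst_of_nonpos hμ (by linarith : s ≤ 0)
    have h2 : exp (2 * (s + a)) ≤ 1 := exp_le_one_iff.2 (by linarith)
    have h3 := mul_le_mul_of_nonneg_left h2 hK0.le
    rw [hK] at h3 ⊢
    linarith
  have hlower : ∀ t, -a ≤ t → (∀ r ∈ Icc (-a) t, -1 - 1 / L ≤ G r) →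
      a - K - (1 + 1 / L) * (t + a) ≤ g t := fun t ht hG => by
    have h1 := h.le_fst_sub ht hG
    have h2 := hearly (-a) le_rfl
    linarith
  obtain ⟨s, hs, hGs⟩ : ∃ s ∈ Icc (-a) (-a + L), G s ≤ -1 - 1 / L := by
    by_contra! hn
    have h1 := le_of_hasDerivAt_nonneg (by linarith : -a ≤ -a + L)
      (fun r _ => ((h.deriv_snd r).neg).sub ((hasDerivAt_id r).const_mul (c / 2))) (fun r hr => by
        have e1 := hlower r hr.1 fun q hq => (hn q ⟨hq.1, hq.2.trans hr.2⟩).le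
        have e2 : 1 / L * (r + a) ≤ 1 := by
          rw [one_div, inv_mul_le_one₀ hL0]; linarith [hr.2]
        have e3 := exp_le_sechSq (by linarith [hr.2] : r ≤ 0)
        have e4 : c ≤ μ / 4 * sechSq r * exp (2 * g r) := by
          rw [hc, mul_assoc]
          refine mul_le_mul_of_nonneg_left ?_ (by positivity)
          refine le_trans ?_ (mul_le_mul_of_nonneg_right e3 (exp_pos _).le)
          rw [← exp_add]
          exact exp_le_exp.2 (by linarith)
        have e5 : μ / 4 * sechSq r ≤ c / 2 := by
          have f1 : exp (2 * r) ≤ exp (2 * (L + -a)) := exp_le_exp.2 (by linarith [hr.2])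
          have f2 := mul_le_mul_of_nonneg_left ((sechSq_le_exp r).trans
            (mul_le_mul_of_nonneg_left f1 (by norm_num))) (by positivity : 0 ≤ μ / 4)
          linarith
        linarith)
    have h2 : G (-a) ≤ 0 := h.snd_nonpos hμ (fun t ht => by linarith [hearly t ht]) le_rfl
    have h3 := hn (-a + L) ⟨by linarith, le_rfl⟩
    have h4 : c / 2 * L = c / 2 + 2 := by rw [hL]; field_simp; ring
    simp only [Pi.sub_apply, Pi.neg_apply, id] at h1
    linarith
  have hfinish : ∀ t ∈ Icc (-a) (-a + L), (∀ r ∈ Icc (-a) t, -1 - 1 / L ≤ G r) →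
      ∀ s ≤ t, 0 < g s := fun t ht hG s hst => by
    rcases le_total s (-a) with hsa | hsa
    · linarith [hearly s hsa]
    · have h1 := hlower s hsa fun r hr => hG r ⟨hr.1, hr.2.trans hst⟩
      have h2 : (1 + 1 / L) * (s + a) ≤ 2 * L :=
        mul_le_mul (by linarith) (by linarith [ht.2]) (by linarith) (by norm_num)
      linarith
  by_cases hstart : G (-a) ≤ -1 - 1 / L
  · refine ⟨-a, ⟨le_rfl, by linarith⟩, hstart, fun s hs => by linarith [hearly s hs]⟩
  · push Not at hstart
    obtain ⟨t, ht, ht0, htpos⟩ := exists_first_zero (u := fun t => G t + (1 + 1 / L))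
      (h.cont_snd.add continuous_const) hs.1 (by linarith) (by linarith)
    have htL : t ∈ Icc (-a) (-a + L) := ⟨ht.1.le, ht.2.trans hs.2⟩
    refine ⟨t, htL, by linarith, hfinish t htL fun r hr => ?_⟩
    rcases hr.2.eq_or_lt with rfl | hlt
    · linarith
    · linarith [htpos r ⟨hr.1, hlt⟩]

/-- For large central values `g` crosses zero early, with slope in `[-3, -1]`. -/
lemma eventually_exists_first_zero {μ : ℝ} (hμ : 0 < μ) {T : ℝ} (hT : T ≤ 0)
    (hTm : μ / 2 - 1 ≤ tailMass μ T) :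
    ∀ᶠ a in atTop, ∀ g G, IsLogSol μ a g G →
      ∃ t ≤ T, g t = 0 ∧ (∀ s < t, 0 < g s) ∧ -3 ≤ G t ∧ G t ≤ -1 := by
  obtain ⟨L, hL1, hL⟩ := exists_eventually_snd_le hμ
  have hL0 : 0 < L := by linarith
  filter_upwards [hL, eventually_ge_atTop ((L - T) * (L + 1))] with a ha₁ ha₂ g G h
  obtain ⟨t₁, ht₁, hG₁, hpos₁⟩ := ha₁ g G h
  have ht₁T : t₁ ≤ T := by nlinarith [ht₁.2]
  obtain ⟨s, hs, hs0⟩ : ∃ s ∈ Icc t₁ T, g s ≤ 0 := by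
    by_contra! hn
    have h1 := h.fst_sub_le ht₁T (c := -1 - 1 / L) fun r hr =>
      (h.snd_le_snd hμ hr.1 fun q hq => (hn q ⟨hq.1, hq.2.trans hr.2⟩).le).trans hG₁
    have h2 := h.fst_le_of_nonneg hμ fun t ht => (hpos₁ t ht).le
    have h3 := hn T ⟨ht₁T, le_rfl⟩
    have h4 : a ≤ (1 + 1 / L) * (T - t₁) := by
      have e1 : (1 + 1 / L) * (T - t₁) = (L + 1) * (T - t₁) / L := by field_simp
      rw [e1, le_div_iff₀ hL0]
      nlinarith [ht₁.2]
    linarith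
  obtain ⟨t, ht, ht0, htpos⟩ := exists_first_zero h.cont_fst hs.1 (hpos₁ t₁ le_rfl) hs0
  have hpos : ∀ s < t, 0 < g s := fun s hst => by
    rcases le_total s t₁ with h1 | h1
    · exact hpos₁ s h1
    · exact htpos s ⟨h1, hst⟩
  have hnn : ∀ s ≤ t, 0 ≤ g s := fun s hst => by
    rcases hst.eq_or_lt with rfl | h1
    · exact ht0.ge
    · exact (hpos s h1).le
  refine ⟨t, ht.2.trans hs.2, ht0, hpos, ?_, ?_⟩
  · have h1 := h.energy_le hμ hnn
    have h2 : tailMass μ T ≤ tailMass μ t := by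
      refine neg_le_neg_iff.1 (le_of_hasDerivAt_nonneg (u := -tailMass μ) (ht.2.trans hs.2)
        (fun r _ => (hasDerivAt_tailMass μ r).neg) fun r _ => ?_)
      have := sechSq_pos r
      rw [neg_neg]; positivity
    by_contra! hn
    nlinarith
  · have h1 := h.snd_le_snd hμ ht.1.le fun r hr => hnn r hr.2
    have : 0 < 1 / L := by positivity
    linarith

/-- For large central values the angle is at most `3π`. -/
lemma eventually_totalPhase_le_three_mul_pi {μ : ℝ} (hμ : 12 < μ) :
    ∀ᶠ a in atTop, ∀ g G, IsLogSol μ a g G → totalPhase (potential μ g) g G ≤ 3 * π := by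
  have hμ0 : 0 < μ := by linarith
  obtain ⟨τ, hτ, hτ0⟩ := (((tendsto_tailMass_atBot μ).eventually_const_lt
    (show μ / 2 - 1 / 4 < μ / 2 by linarith)).and (eventually_le_atBot 0)).exists
  obtain ⟨t₀, ht₀, hsmall⟩ := exists_exp_mul_tailMass_lt μ (by norm_num : (0:ℝ) < 1 / 2) 0
  have hτt₀ : τ ≤ t₀ := hτ0.trans ht₀
  set T := τ - 4 / 3 * (2 + μ / 2 * (t₀ - τ)) with hT
  have hTτ : T < τ := by
    have : 0 ≤ μ / 2 * (t₀ - τ) := mul_nonneg (by positivity) (by linarith)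
    linarith
  have hWanti : Antitone (tailMass μ) :=
    antitone_of_hasDerivAt_nonpos (hasDerivAt_tailMass μ) fun r => by
      have := sechSq_pos r
      exact neg_nonpos.2 (by positivity)
  have hWle : ∀ t, tailMass μ t ≤ μ / 2 := fun t =>
    hWanti.ge_of_tendsto (tendsto_tailMass_atBot μ) t
  filter_upwards [eventually_exists_first_zero hμ0 (by linarith : T ≤ 0)
    (by linarith [hWanti hTτ.le]), eventually_gt_atTop 0] with a hfirst ha0 g G h
  obtain ⟨s, hsT, hs0, hpos, hs3, hs1⟩ := hfirst g G h
  have hanti := h.antitone_add_tailMass hμ0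
  have hGτ : ∀ r ∈ Icc s τ, G r ≤ -(3 / 4) := fun r hr => by
    have h1 := hanti hr.1
    have h2 := hWanti hr.2
    have h3 := hWle s
    simp only at h1
    linarith
  have hgτ : ∀ t ∈ Ioc s τ, g t ≤ -(3 / 4) * (t - s) := fun t ht => by
    have := h.fst_sub_le ht.1.le fun r hr => hGτ r ⟨hr.1, hr.2.trans ht.2⟩
    linarith
  have hgt₀ : ∀ t ∈ Icc τ t₀, g t ≤ -2 := fun t ht => by
    have h1 := h.fst_sub_le ht.1 (c := μ / 2) fun r _ => by
      have h1 := h.add_tailMass_le hμ0 r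
      have h2 := tailMass_pos hμ0 r
      linarith
    have h2 := hgτ τ ⟨by linarith, le_rfl⟩
    have h3 : μ / 2 * (t - τ) ≤ μ / 2 * (t₀ - τ) :=
      mul_le_mul_of_nonneg_left (by linarith [ht.2]) (by positivity)
    linarith
  have hneg : ∀ t ∈ Ioc s t₀, g t < 0 := fun t ht => by
    rcases le_total t τ with h1 | h1
    · linarith [hgτ t ⟨ht.1, h1⟩, ht.1]
    · linarith [hgt₀ t ⟨h1, ht.2⟩]
  have hinc : ∀ r t, s ≤ r → r < t → t ≤ t₀ → G r < G t := fun r t hr hrt ht =>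
    h.snd_lt_snd_of_neg hμ0 hrt fun q hq => hneg q ⟨hr.trans_lt hq.1, hq.2.le.trans ht⟩
  have hGt₀ : exp μ * tailMass μ t₀ < G t₀ := by
    have h1 := le_of_hasDerivAt_nonneg hτt₀
      (fun r _ => (h.deriv_snd r).add ((hasDerivAt_tailMass μ r).const_mul (3 / 4)))
      fun r hr => by
        have e1 : exp (2 * g r) ≤ exp (-4) := exp_le_exp.2 (by linarith [hgt₀ r hr])
        have e2 : exp (-4) ≤ 1 / 4 := by
          rw [exp_neg, inv_le_comm₀ (exp_pos _) (by norm_num)]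
          linarith [add_one_le_exp (4 : ℝ)]
        have e3 : 0 ≤ μ / 4 * sechSq r := mul_nonneg (by positivity) (sechSq_pos r).le
        nlinarith
    have h2 := hinc s τ le_rfl (by linarith) hτt₀
    have h3 : tailMass μ t₀ ≤ exp μ * tailMass μ t₀ :=
      le_mul_of_one_le_left (tailMass_pos hμ0 _).le (one_le_exp hμ0.le)
    simp only [Pi.add_apply] at h1
    linarith
  obtain ⟨T₂, hT₂⟩ := h.exists_forall_eq_of_zero hμ0 ht₀ hGt₀
  obtain ⟨T₁, hT₁⟩ : ∃ T₁, ∀ t ∈ Icc s t₀, G t = 0 → t = T₁ := by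
    by_cases hz : ∃ r ∈ Icc s t₀, G r = 0
    · obtain ⟨r, hr, hr0⟩ := hz
      refine ⟨r, fun t ht h0 => ?_⟩
      rcases lt_trichotomy t r with hlt | heq | hlt
      · linarith [hinc t r ht.1 hlt hr.2]
      · exact heq
      · linarith [hinc r t hr.1 hlt ht.2]
    · exact ⟨0, fun t ht h0 => (hz ⟨t, ht, h0⟩).elim⟩
  obtain ⟨C, hL⟩ := h.exists_isLinSol hμ0 ha0.ne'
  refine hL.totalPhase_le_of_forall_eq_or (T₁ := T₁) (T₂ := T₂) fun t h0 => ?_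
  rcases le_total t s with hts | hts
  · exact absurd h0 (h.snd_neg hμ0 hpos hts).ne
  · rcases le_total t t₀ with ht | ht
    · exact Or.inl (hT₁ t ⟨hts, ht⟩ h0)
    · exact Or.inr (hT₂ t ht h0)

/-! ### Back to the radial variable -/

namespace IsRadialSol

variable {μ a : ℝ} {f p : ℝ → ℝ}

lemma snd_zero (h : IsRadialSol μ a f p) : p 0 = 0 := by
  obtain ⟨C, -, hC⟩ := h.bound_snd 0
  simpa using hC 0 ⟨le_rfl, le_rfl⟩

lemma tendsto_snd_zero (h : IsRadialSol μ a f p) : Tendsto p (𝓝[>] 0) (𝓝 0) := by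
  obtain ⟨C, -, hC⟩ := h.bound_snd 1
  have h1 : Tendsto (fun r : ℝ => C * r) (𝓝[>] 0) (𝓝 0) := by
    have := ((tendsto_id (x := 𝓝 (0 : ℝ))).const_mul C).mono_left (nhdsWithin_le_nhds (s := Ioi 0))
    rwa [mul_zero] at this
  refine squeeze_zero_norm' ?_ h1
  filter_upwards [Ioc_mem_nhdsGT one_pos] with r hr using hC r ⟨hr.1.le, hr.2⟩

lemma tendsto_coeff (h : IsRadialSol μ a f p) :
    Tendsto (fun r => μ / (1 + r ^ 2) ^ 2 * (exp (2 * f r) - 1)) (𝓝[>] 0)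
      (𝓝 (μ * (exp (2 * a) - 1))) := by
  have h1 : Tendsto (fun r : ℝ => μ / (1 + r ^ 2) ^ 2) (𝓝[>] 0) (𝓝 μ) := by
    have : Continuous fun r : ℝ => μ / (1 + r ^ 2) ^ 2 :=
      continuous_const.div (by fun_prop) fun r => by positivity
    simpa using (this.tendsto 0).mono_left nhdsWithin_le_nhds
  exact h1.mul ((h.cont_zero.const_mul 2).rexp.sub_const 1)

lemma tendsto_snd_div_sq (h : IsRadialSol μ a f p) :
    Tendsto (fun r => p r / r ^ 2) (𝓝[>] 0) (𝓝 (-(μ * (exp (2 * a) - 1)) / 2)) := by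
  refine HasDerivAt.lhopital_zero_nhdsGT (f' := fun r => -(μ * r / (1 + r ^ 2) ^ 2 *
    (exp (2 * f r) - 1))) (g' := fun r => 2 * r) ?_ ?_ ?_ h.tendsto_snd_zero ?_ ?_
  · filter_upwards [self_mem_nhdsWithin] with r hr using h.deriv_snd r hr
  · exact Eventually.of_forall fun r => by simpa using hasDerivAt_pow 2 r
  · filter_upwards [self_mem_nhdsWithin] with r hr
    exact (mul_pos two_pos hr).ne'
  · have := (continuous_pow 2 : Continuous fun r : ℝ => r ^ 2).tendsto 0
    simp only [ne_eq, OfNat.ofNat_ne_zero, not_false_eq_true, zero_pow] at this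
    exact this.mono_left nhdsWithin_le_nhds
  · refine (h.tendsto_coeff.neg.div_const 2).congr' ?_
    filter_upwards [self_mem_nhdsWithin] with r hr
    have hr' : r ≠ 0 := (mem_Ioi.1 hr).ne'
    field_simp

lemma tendsto_snd_div (h : IsRadialSol μ a f p) :
    Tendsto (fun r => p r / r) (𝓝[>] 0) (𝓝 0) := by
  have h1 := h.tendsto_snd_div_sq.mul
    ((continuous_id.tendsto (0 : ℝ)).mono_left (nhdsWithin_le_nhds (s := Ioi 0)))
  rw [id, mul_zero] at h1
  refine h1.congr' ?_
  filter_upwards [self_mem_nhdsWithin] with r hr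
  have hr' : r ≠ 0 := (mem_Ioi.1 hr).ne'
  simp only [id]
  field_simp

lemma hasDerivAt_snd_div (h : IsRadialSol μ a f p) {r : ℝ} (hr : 0 < r) :
    HasDerivAt (fun r => p r / r)
      (-(μ / (1 + r ^ 2) ^ 2 * (exp (2 * f r) - 1)) - p r / r ^ 2) r :=
  ((h.deriv_snd r hr).div (hasDerivAt_id r) hr.ne').congr_deriv (by
    simp only [id]; field_simp)

end IsRadialSol

lemma hasDerivWithinAt_Ici_zero {u v : ℝ → ℝ} {l : ℝ} (h : ∀ r > 0, HasDerivAt u (v r) r)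
    (hu : Tendsto u (𝓝[>] 0) (𝓝 (u 0))) (hv : Tendsto v (𝓝[>] 0) (𝓝 l)) :
    HasDerivWithinAt u l (Ici 0) 0 :=
  hasDerivWithinAt_Ici_of_tendsto_deriv (s := Ioi 0)
    (fun r hr => (h r hr).differentiableAt.differentiableWithinAt) hu self_mem_nhdsWithin
    (hv.congr' (by filter_upwards [self_mem_nhdsWithin] with r hr using (h r hr).deriv.symm))

lemma contDiffOn_one_Ici_zero {u v : ℝ → ℝ} {l : ℝ} (h : ∀ r > 0, HasDerivAt u (v r) r)
    (hu : Tendsto u (𝓝[>] 0) (𝓝 (u 0))) (hv : Tendsto v (𝓝[>] 0) (𝓝 l))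
    (hc : ContinuousOn v (Ioi 0)) : ContDiffOn ℝ 1 u (Ici 0) := by
  have hd : ∀ r ∈ Ici (0 : ℝ), HasDerivWithinAt u (Function.update v 0 l r) (Ici 0) r := by
    intro r hr
    rcases (mem_Ici.1 hr).eq_or_lt with rfl | hr'
    · rw [Function.update_self]
      exact hasDerivWithinAt_Ici_zero h hu hv
    · rw [Function.update_of_ne hr'.ne']
      exact (h r hr').hasDerivWithinAt
  rw [show (1 : WithTop ℕ∞) = 0 + 1 by norm_num,
    contDiffOn_succ_iff_derivWithin (uniqueDiffOn_Ici 0)]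
  refine ⟨fun r hr => (hd r hr).differentiableWithinAt, by simp, ?_⟩
  rw [contDiffOn_zero]
  refine ContinuousOn.congr (f := Function.update v 0 l) ?_ fun r hr =>
    (hd r hr).derivWithin (uniqueDiffOn_Ici 0 r hr)
  rw [continuousOn_update_iff]
  refine ⟨hc.mono fun r hr => lt_of_le_of_ne hr.1 (Ne.symm hr.2), fun _ => ?_⟩
  rwa [Ici_sdiff_left]

/-- A radial solution whose flux vanishes at infinity is normalized. -/
lemma IsRadialSol.isNormalizedSol {μ a : ℝ} {f p : ℝ → ℝ} (h : IsRadialSol μ a f p) (hμ : 0 < μ)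
    (hp : Tendsto p atTop (𝓝 0)) : IsNormalizedSol μ f := by
  have hf0 : Tendsto f (𝓝[>] 0) (𝓝 (f 0)) := by rw [h.fst_zero]; exact h.cont_zero
  have hd0 : HasDerivWithinAt f 0 (Ici 0) 0 :=
    hasDerivWithinAt_Ici_zero h.deriv_fst hf0 h.tendsto_snd_div
  have hd : ∀ r ∈ Ici (0 : ℝ), HasDerivWithinAt f (p r / r) (Ici 0) r := by
    intro r hr
    rcases (mem_Ici.1 hr).eq_or_lt with rfl | hr'
    · rwa [div_zero]
    · exact (h.deriv_fst r hr').hasDerivWithinAt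
  have hu : ∀ r ∈ Ioi (0 : ℝ), HasDerivAt (fun r => -(p r + μ / (2 * (1 + r ^ 2))) / μ)
      (exp (2 * f r) / (1 + r ^ 2) ^ 2 * r) r := fun r hr =>
    (((h.deriv_snd r hr).add (hasDerivAt_barrier μ r)).neg.div_const μ).congr_deriv (by
      field_simp; ring)
  have hucont : ContinuousWithinAt (fun r => -(p r + μ / (2 * (1 + r ^ 2))) / μ) (Ici 0) 0 := by
    have h1 : ContinuousWithinAt p (Ici 0) 0 := by
      refine continuousWithinAt_Ioi_iff_Ici.1 ?_
      rw [ContinuousWithinAt, h.snd_zero]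
      exact h.tendsto_snd_zero
    exact ((h1.add (hasDerivAt_barrier μ 0).continuousAt.continuousWithinAt).neg).div_const μ
  have hulim : Tendsto (fun r => -(p r + μ / (2 * (1 + r ^ 2))) / μ) atTop (𝓝 0) := by
    have h1 : Tendsto (fun r : ℝ => μ / (2 * (1 + r ^ 2))) atTop (𝓝 0) :=
      tendsto_const_nhds.div_atTop ((tendsto_atTop_add_const_left _ 1
        (tendsto_pow_atTop two_ne_zero)).const_mul_atTop two_pos)
    simpa using (hp.add h1).neg.div_const μ
  have hunn : ∀ r ∈ Ioi (0 : ℝ), 0 ≤ exp (2 * f r) / (1 + r ^ 2) ^ 2 * r := fun r hr =>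
    mul_nonneg (by positivity) (mem_Ioi.1 hr).le
  refine ⟨?_, hd0.derivWithin (uniqueDiffOn_Ici 0 0 self_mem_Ici), fun r hr => ?_,
    integrableOn_Ioi_deriv_of_nonneg hucont hu hunn hulim, ?_⟩
  · rw [show (2 : WithTop ℕ∞) = 1 + 1 by norm_num,
      contDiffOn_succ_iff_derivWithin (uniqueDiffOn_Ici 0)]
    refine ⟨fun r hr => (hd r hr).differentiableWithinAt, by simp, ?_⟩
    refine ContDiffOn.congr (f := fun r => p r / r) ?_ fun r hr =>
      (hd r hr).derivWithin (uniqueDiffOn_Ici 0 r hr)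
    refine contDiffOn_one_Ici_zero (fun r hr => h.hasDerivAt_snd_div hr) ?_
      (h.tendsto_coeff.neg.sub h.tendsto_snd_div_sq) fun r hr => ?_
    · simpa using h.tendsto_snd_div
    · have hf := (h.deriv_fst r hr).continuousAt
      have hp := (h.deriv_snd r hr).continuousAt
      have hr' : r ^ 2 ≠ 0 := pow_ne_zero 2 (mem_Ioi.1 hr).ne'
      have h1 : ContinuousAt (fun r : ℝ => μ / (1 + r ^ 2) ^ 2) r :=
        (continuous_const.div (by fun_prop) fun r => by positivity).continuousAt
      exact (((h1.mul ((hf.const_mul 2).rexp.sub continuousAt_const)).neg).sub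
        (hp.div (continuousAt_id.pow 2) hr')).continuousWithinAt
  · have h1 : deriv f =ᶠ[𝓝 r] fun r => p r / r := by
      filter_upwards [Ioi_mem_nhds hr] with s hs using (h.deriv_fst s hs).deriv
    rw [h1.deriv_eq, (h.hasDerivAt_snd_div hr).deriv, (h.deriv_fst r hr).deriv]
    field_simp
    ring
  · rw [integral_Ioi_of_hasDerivAt_of_nonneg hucont hu hunn hulim, h.snd_zero]
    field_simp
    ring

/-! ### Selecting the solutions -/

lemma isLogFamily_of_radial {μ B : ℝ} {f p : ℝ → ℝ → ℝ}
    (h : ∀ a ≤ B, IsRadialSol μ a (f a) (p a))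
    (hlip : ∀ R, ∃ C ≥ 0, ∀ a ≤ B, ∀ b ≤ B, ∀ r ∈ Icc 0 R,
      |f a r - f b r| ≤ C * |a - b| ∧ |p a r - p b r| ≤ C * |a - b| * r)
    (h0 : ∀ r ≥ 0, f 0 r = 0) :
    IsLogFamily μ B (fun a t => f a (exp t)) (fun a t => p a (exp t)) where
  sol a ha := (h a ha).isLogSol
  lip T := by
    obtain ⟨C, hC, H⟩ := hlip (exp T)
    refine ⟨C * (1 + exp T), by positivity, fun a ha b hb t ht => ?_⟩
    have ht' : exp t ≤ exp T := exp_le_exp.2 ht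
    obtain ⟨h1, h2⟩ := H a ha b hb (exp t) ⟨(exp_pos t).le, ht'⟩
    have h3 : 0 ≤ C * |a - b| := by positivity
    have h4 := mul_le_mul_of_nonneg_left ht' h3
    have h5 := mul_nonneg h3 (exp_pos T).le
    constructor <;> linarith
  zero t := h0 _ (exp_pos t).le

/-- Between central values of small and large angle, every intermediate multiple of `π` occurs. -/
lemma IsLogFamily.exists_familyPhase_eq {μ B : ℝ} {g G : ℝ → ℝ → ℝ} (h : IsLogFamily μ B g G)
    (hμ : 0 < μ) {u v : ℝ} (hsub : uIcc u v ⊆ Iic B \ {0}) {c k : ℕ}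
    (hu : familyPhase μ g G u ≤ c * π) (hv : k * π ≤ familyPhase μ g G v) {j : ℕ} (hj : c ≤ j)
    (hjk : j ≤ k) : ∃ a ∈ uIcc u v, familyPhase μ g G a = j * π := by
  have hj' : (c : ℝ) * π ≤ j * π :=
    mul_le_mul_of_nonneg_right (by exact_mod_cast hj) pi_pos.le
  have hjk' : (j : ℝ) * π ≤ k * π :=
    mul_le_mul_of_nonneg_right (by exact_mod_cast hjk) pi_pos.le
  exact intermediate_value_uIcc ((h.continuousOn_familyPhase hμ).mono hsub)
    (Icc_subset_uIcc ⟨hu.trans hj', hjk'.trans hv⟩)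

lemma exists_isLogFamily_isNormalizedSol {k : ℕ} (hk : 2 ≤ k) {μ : ℝ}
    (hμ : 2 * (k : ℝ) * ((k : ℝ) + 1) < μ) :
    ∃ (f : ℝ → ℝ → ℝ) (Φ : ℝ → ℝ) (b c : ℕ → ℝ),
      (∀ r ≥ 0, f 0 r = 0) ∧ IsNormalizedSol μ (f 0) ∧
      (∀ j, 2 ≤ j → j ≤ k →
        b j < 0 ∧ Φ (b j) = j * π ∧ f (b j) 0 = b j ∧ IsNormalizedSol μ (f (b j))) ∧
      (∀ j, 3 ≤ j → j ≤ k →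
        0 < c j ∧ Φ (c j) = j * π ∧ f (c j) 0 = c j ∧ IsNormalizedSol μ (f (c j))) := by
  have hk' : (2 : ℝ) ≤ k := by exact_mod_cast hk
  have hμ12 : 12 < μ := by nlinarith
  have hμ0 : 0 < μ := by linarith
  obtain ⟨A, hA0, hA⟩ := exists_totalPhase_le_two_mul_pi hμ0
  obtain ⟨B, hB, hB0⟩ :=
    ((eventually_totalPhase_le_three_mul_pi hμ12).and (eventually_gt_atTop 0)).exists
  obtain ⟨f, p, hsol, hlip, hf0⟩ := exists_radial_family hμ0 hB0.le
  have hfam := isLogFamily_of_radial hsol hlip hf0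
  set Φ := familyPhase μ (fun a t => f a (exp t)) (fun a t => p a (exp t))
  obtain ⟨ε, hε, hΦ⟩ := hfam.exists_le_familyPhase hB0.le k hμ
  obtain ⟨e, he0, he⟩ := exists_between (lt_min hε hB0)
  have hsub₁ : ∀ a ∈ uIcc (-A) (-e), a < 0 := fun a ha =>
    ha.2.trans_lt (max_lt (by linarith) (by linarith))
  have hsub₂ : ∀ a ∈ uIcc B e, 0 < a ∧ a ≤ B := fun a ha =>
    ⟨(lt_min hB0 he0).trans_le ha.1, ha.2.trans (max_le le_rfl (he.le.trans (min_le_right _ _)))⟩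
  have hb : ∀ j, ∃ a, 2 ≤ j → j ≤ k → a < 0 ∧ Φ a = j * π := fun j => by
    by_cases hj : 2 ≤ j ∧ j ≤ k
    · obtain ⟨a, ha, hΦa⟩ := hfam.exists_familyPhase_eq (u := -A) (v := -e) hμ0
        (fun a ha => ⟨(hsub₁ a ha).le.trans hB0.le, (hsub₁ a ha).ne⟩) (c := 2)
        (by exact_mod_cast hA _ _ (hfam.sol (-A) (by linarith)))
        (hΦ _ (by linarith) (by linarith) (by
          rw [abs_neg, abs_of_pos he0]; exact he.trans_le (min_le_left _ _))) hj.1 hj.2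
      exact ⟨a, fun _ _ => ⟨hsub₁ a ha, hΦa⟩⟩
    · exact ⟨0, fun h1 h2 => (hj ⟨h1, h2⟩).elim⟩
  have hc : ∀ j, ∃ a, 3 ≤ j → j ≤ k → 0 < a ∧ a ≤ B ∧ Φ a = j * π := fun j => by
    by_cases hj : 3 ≤ j ∧ j ≤ k
    · obtain ⟨a, ha, hΦa⟩ := hfam.exists_familyPhase_eq (u := B) (v := e) hμ0
        (fun a ha => ⟨(hsub₂ a ha).2, (hsub₂ a ha).1.ne'⟩) (c := 3)
        (by exact_mod_cast hB _ _ (hfam.sol B le_rfl))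
        (hΦ _ (he.le.trans (min_le_right _ _)) he0.ne' (by
          rw [abs_of_pos he0]; exact he.trans_le (min_le_left _ _))) hj.1 hj.2
      exact ⟨a, fun _ _ => ⟨(hsub₂ a ha).1, (hsub₂ a ha).2, hΦa⟩⟩
    · exact ⟨0, fun h1 h2 => (hj ⟨h1, h2⟩).elim⟩
  have hnorm : ∀ a ≤ B, a ≠ 0 → ∀ j : ℕ, Φ a = j * π → IsNormalizedSol μ (f a) := by
    intro a haB ha0 j hj
    obtain ⟨C, hL⟩ := (hfam.sol a haB).exists_isLinSol hμ0 ha0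
    have h1 := (hL.tendsto_snd_of_totalPhase_eq hj).comp tendsto_log_atTop
    refine (hsol a haB).isNormalizedSol hμ0 (h1.congr' ?_)
    filter_upwards [eventually_gt_atTop 0] with r hr
    simp only [Function.comp_apply, exp_log hr]
  have hnorm₀ : IsNormalizedSol μ (f 0) := by
    refine (hsol 0 hB0.le).isNormalizedSol hμ0 (tendsto_const_nhds.congr' ?_)
    filter_upwards [eventually_gt_atTop 0] with r hr
    have h1 : HasDerivAt (f 0) 0 r := (hasDerivAt_const r (0 : ℝ)).congr_of_eventuallyEq (by
      filter_upwards [Ioi_mem_nhds hr] with s hs using hf0 s (mem_Ioi.1 hs).le)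
    have h2 := ((hsol 0 hB0.le).deriv_fst r hr).unique h1
    exact ((div_eq_zero_iff.1 h2).resolve_right hr.ne').symm
  choose b hb using hb
  choose c hc using hc
  refine ⟨f, Φ, b, c, hf0, hnorm₀, fun j hj hjk => ?_, fun j hj hjk => ?_⟩
  · obtain ⟨h1, h2⟩ := hb j hj hjk
    have hB' : b j ≤ B := h1.le.trans hB0.le
    exact ⟨h1, h2, (hsol _ hB').fst_zero, hnorm _ hB' h1.ne j h2⟩
  · obtain ⟨h1, hB', h2⟩ := hc j hj hjk
    exact ⟨h1, h2, (hsol _ hB').fst_zero, hnorm _ hB' h1.ne' j h2⟩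

/-- For every integer `k ≥ 2` and every `μ > 2k(k+1)`, there are at least
`2(k−2)+2` pairwise distinct radial solutions of the normalized equation, one of
which is the zero function. -/
theorem multiplicity_normalized (k : ℕ) (hk : 2 ≤ k) (μ : ℝ)
    (hμ : 2 * (k : ℝ) * ((k : ℝ) + 1) < μ) :
    ∃ f : Fin (2 * (k - 2) + 2) → ℝ → ℝ,
      (∀ i, IsNormalizedSol μ (f i)) ∧
      (∀ i j, i ≠ j → ¬ EqOn (f i) (f j) (Ici 0)) ∧
      (∃ i, ∀ r : ℝ, 0 ≤ r → f i r = 0) := by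
  obtain ⟨f, Φ, b, c, hf0, hn0, hb, hc⟩ := exists_isLogFamily_isNormalizedSol hk hμ
  set s : ℕ → ℝ := fun i => if i = 0 then 0 else if i < k then b (i + 1) else c (i + 3 - k) with hs
  have hs0 : s 0 = 0 := if_pos rfl
  have hsb : ∀ i, i ≠ 0 → i < k → s i = b (i + 1) := fun i h1 h2 => by
    rw [hs]; simp only [if_neg h1, if_pos h2]
  have hsc : ∀ i, i ≠ 0 → ¬ i < k → s i = c (i + 3 - k) := fun i h1 h2 => by
    rw [hs]; simp only [if_neg h1, if_neg h2]
  have hinj : ∀ i j : ℕ, i < 2 * (k - 2) + 2 → j < 2 * (k - 2) + 2 → s i = s j → i = j := by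
    have hπ : ∀ i j : ℕ, (i : ℝ) * π = j * π → i = j := fun i j h => by
      exact_mod_cast mul_right_cancel₀ pi_ne_zero h
    intro i j hi hj hij
    rcases eq_or_ne i 0 with rfl | hi0 <;> rcases eq_or_ne j 0 with rfl | hj0
    · rfl
    · rw [hs0] at hij
      by_cases hjk : j < k
      · rw [hsb j hj0 hjk] at hij
        exact absurd hij.symm (hb (j + 1) (by omega) (by omega)).1.ne
      · rw [hsc j hj0 hjk] at hij
        exact absurd hij (hc (j + 3 - k) (by omega) (by omega)).1.ne
    · rw [hs0] at hij
      by_cases hik : i < k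
      · rw [hsb i hi0 hik] at hij
        exact absurd hij (hb (i + 1) (by omega) (by omega)).1.ne
      · rw [hsc i hi0 hik] at hij
        exact absurd hij.symm (hc (i + 3 - k) (by omega) (by omega)).1.ne
    · by_cases hik : i < k <;> by_cases hjk : j < k
      · rw [hsb i hi0 hik, hsb j hj0 hjk] at hij
        have h1 := (hb (i + 1) (by omega) (by omega)).2.1
        rw [hij, (hb (j + 1) (by omega) (by omega)).2.1] at h1
        have := hπ _ _ h1
        omega
      · rw [hsb i hi0 hik, hsc j hj0 hjk] at hij
        have h1 := (hb (i + 1) (by omega) (by omega)).1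
        have h2 := (hc (j + 3 - k) (by omega) (by omega)).1
        linarith
      · rw [hsc i hi0 hik, hsb j hj0 hjk] at hij
        have h1 := (hb (j + 1) (by omega) (by omega)).1
        have h2 := (hc (i + 3 - k) (by omega) (by omega)).1
        linarith
      · rw [hsc i hi0 hik, hsc j hj0 hjk] at hij
        have h1 := (hc (i + 3 - k) (by omega) (by omega)).2.1
        rw [hij, (hc (j + 3 - k) (by omega) (by omega)).2.1] at h1
        have := hπ _ _ h1
        omega
  have hsol : ∀ i : ℕ, i < 2 * (k - 2) + 2 → f (s i) 0 = s i ∧ IsNormalizedSol μ (f (s i)) := by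
    intro i hi
    rcases eq_or_ne i 0 with rfl | hi0
    · rw [hs0]
      exact ⟨hf0 0 le_rfl, hn0⟩
    · by_cases hik : i < k
      · rw [hsb i hi0 hik]
        exact (hb (i + 1) (by omega) (by omega)).2.2
      · rw [hsc i hi0 hik]
        exact (hc (i + 3 - k) (by omega) (by omega)).2.2
  refine ⟨fun i => f (s i), fun i => (hsol i i.2).2, fun i j hij heq => hij ?_, ⟨0, by omega⟩, ?_⟩
  · have h1 := heq self_mem_Ici
    simp only [(hsol i i.2).1, (hsol j j.2).1] at h1
    exact Fin.ext (hinj i j i.2 j.2 h1)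
  · simpa only [hs0] using hf0
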